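/- arXiv:math/0003037 — 4 statements merged into one kernel-verified Lean document; each statement's English description precedes it below -/
import Mathlib

section
/- If Condition (R) holds, then M is geodesically connected. -/
open Set Filter MeasureTheory Topology
open scoped ENNReal NNReal

noncomputable section

namespace GRW

/-- The open interval `(a,b)` (extended-real endpoints) as a subset of `ℝ`. -/
def II (aE bE : EReal) : Set ℝ := {τ : ℝ | aE < (τ : EReal) ∧ (τ : EReal) < bE}

/-- `G = 1/f²`. -/
def G (f : ℝ → ℝ) (τ : ℝ) : ℝ := ((f τ) ^ 2)⁻¹

/-- The nonnegative integrand `f⁻² (G − D)^{-1/2}`, valued in `[0,∞]`. -/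
def h (f : ℝ → ℝ) (D τ : ℝ) : ℝ≥0∞ :=
  ENNReal.ofReal ((f τ ^ 2 * Real.sqrt (G f τ - D))⁻¹)

/-- A geodesic `t ↦ (σ t, x t)` of `g^f = -dτ² + f(τ)² dx²` defined on `[t0, t1]`,
with values in the spacetime `(a,b) × J`. -/
structure IsGeodesicOn (aE bE : EReal) (f : ℝ → ℝ) (J : Set ℝ)
    (σ x : ℝ → ℝ) (t0 t1 : ℝ) : Prop where
  mem_base : ∀ t ∈ Icc t0 t1, σ t ∈ II aE bE
  mem_fiber : ∀ t ∈ Icc t0 t1, x t ∈ J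
  smooth_base : ContDiffOn ℝ 2 σ (Icc t0 t1)
  smooth_fiber : ContDiffOn ℝ 2 x (Icc t0 t1)
  eq_base : ∀ t ∈ Icc t0 t1,
    derivWithin (derivWithin σ (Icc t0 t1)) (Icc t0 t1) t
      = -(f (σ t) * deriv f (σ t) * (derivWithin x (Icc t0 t1) t) ^ 2)
  eq_fiber : ∀ t ∈ Icc t0 t1,
    derivWithin (derivWithin x (Icc t0 t1)) (Icc t0 t1) t
      = -(2 * (deriv f (σ t) / f (σ t)) * derivWithin σ (Icc t0 t1) t
          * derivWithin x (Icc t0 t1) t)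

/-- The energy `-(τ')² + f(τ)² (x')²` of a curve `(σ, x)` parameterized on `[t0,t1]`. -/
def energyW (f σ x : ℝ → ℝ) (t0 t1 t : ℝ) : ℝ :=
  -(derivWithin σ (Icc t0 t1) t) ^ 2 + (f (σ t)) ^ 2 * (derivWithin x (Icc t0 t1) t) ^ 2

/-- The velocity of a curve `(σ, x)` parameterized on `[t0,t1]`. -/
def velW (σ x : ℝ → ℝ) (t0 t1 t : ℝ) : ℝ × ℝ :=
  (derivWithin σ (Icc t0 t1) t, derivWithin x (Icc t0 t1) t)

/-- Geodesic connectedness of the GRW spacetime `(a,b) × J`. -/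
def GeodConnected (aE bE : EReal) (f : ℝ → ℝ) (J : Set ℝ) : Prop :=
  ∀ τ0 x0 τ0' x0' : ℝ, τ0 ∈ II aE bE → x0 ∈ J → τ0' ∈ II aE bE → x0' ∈ J →
    ∃ (σ x : ℝ → ℝ) (t1 : ℝ), 0 ≤ t1 ∧ IsGeodesicOn aE bE f J σ x 0 t1 ∧
      σ 0 = τ0 ∧ x 0 = x0 ∧ σ t1 = τ0' ∧ x t1 = x0'

/-- Two points are related by a piecewise-`C¹` curve in the spacetime all of whose pieces
satisfy the pointwise condition `P` on (energy density, velocity). -/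
def RelatedVia (aE bE : EReal) (f : ℝ → ℝ) (J : Set ℝ)
    (P : ℝ → ℝ × ℝ → Prop) (z z' : ℝ × ℝ) : Prop :=
  ∃ (n : ℕ) (s : ℕ → ℝ) (σ x : ℝ → ℝ),
    s 0 = 0 ∧ s (n + 1) = 1 ∧ (∀ i ≤ n, s i < s (i + 1)) ∧
    σ 0 = z.1 ∧ x 0 = z.2 ∧ σ 1 = z'.1 ∧ x 1 = z'.2 ∧
    (∀ t ∈ Icc (0:ℝ) 1, σ t ∈ II aE bE ∧ x t ∈ J) ∧
    ContinuousOn σ (Icc 0 1) ∧ ContinuousOn x (Icc 0 1) ∧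
    ∀ i ≤ n, ContDiffOn ℝ 1 σ (Icc (s i) (s (i + 1))) ∧
      ContDiffOn ℝ 1 x (Icc (s i) (s (i + 1))) ∧
      ∀ t ∈ Icc (s i) (s (i + 1)),
        P (energyW f σ x (s i) (s (i + 1)) t) (velW σ x (s i) (s (i + 1)) t)

/-- Timelike related: joined by a piecewise smooth timelike curve. -/
def TimelikeRel (aE bE : EReal) (f : ℝ → ℝ) (J : Set ℝ) (z z' : ℝ × ℝ) : Prop :=
  RelatedVia aE bE f J (fun q _ => q < 0) z z'

/-- Spacelike related: joined by a piecewise smooth spacelike curve. -/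
def SpacelikeRel (aE bE : EReal) (f : ℝ → ℝ) (J : Set ℝ) (z z' : ℝ × ℝ) : Prop :=
  RelatedVia aE bE f J (fun q _ => 0 < q) z z'

/-- Lightlike related: joined by a piecewise smooth lightlike curve with
nowhere-vanishing velocity. -/
def LightlikeRel (aE bE : EReal) (f : ℝ → ℝ) (J : Set ℝ) (z z' : ℝ × ℝ) : Prop :=
  RelatedVia aE bE f J (fun q v => q = 0 ∧ v ≠ 0) z z'

/-- The filter of approach to `b` from inside `(a,b)`. -/
def Fb (bE : EReal) : Filter ℝ := comap (fun τ : ℝ => (τ : EReal)) (𝓝[<] bE)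

/-- The filter of approach to `a` from inside `(a,b)`. -/
def Fa (aE : EReal) : Filter ℝ := comap (fun τ : ℝ => (τ : EReal)) (𝓝[>] aE)

/-- `m_b = liminf_{τ→b} G(τ)`, valued in `EReal`. -/
def mB (bE : EReal) (f : ℝ → ℝ) : EReal := liminf (fun τ => (G f τ : EReal)) (Fb bE)

/-- `m_a = liminf_{τ→a} G(τ)`, valued in `EReal`. -/
def mA (aE : EReal) (f : ℝ → ℝ) : EReal := liminf (fun τ => (G f τ : EReal)) (Fa aE)

/-- `c` witnesses that `G` reaches a relative minimum at `b`: `G > m_b` on `(c,b)`. -/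
def RelMinB (aE bE : EReal) (f : ℝ → ℝ) (c : ℝ) : Prop :=
  c ∈ II aE bE ∧ ∀ τ : ℝ, c < τ → (τ : EReal) < bE → mB bE f < (G f τ : EReal)

/-- `c` witnesses that `G` reaches a relative minimum at `a`: `G > m_a` on `(a,c)`. -/
def RelMinA (aE bE : EReal) (f : ℝ → ℝ) (c : ℝ) : Prop :=
  c ∈ II aE bE ∧ ∀ τ : ℝ, τ < c → aE < (τ : EReal) → mA aE f < (G f τ : EReal)

/-- `∫_c^b f⁻²(G−D)^{-1/2}`, valued in `[0,∞]`. -/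
def IbInt (bE : EReal) (f : ℝ → ℝ) (c D : ℝ) : ℝ≥0∞ :=
  ∫⁻ τ in {τ : ℝ | c < τ ∧ (τ : EReal) < bE}, h f D τ

/-- `∫_a^c f⁻²(G−D)^{-1/2}`, valued in `[0,∞]`. -/
def IaInt (aE : EReal) (f : ℝ → ℝ) (c D : ℝ) : ℝ≥0∞ :=
  ∫⁻ τ in {τ : ℝ | aE < (τ : EReal) ∧ τ < c}, h f D τ

/-- Condition (A) at `b`. -/
def CondA_b (aE bE : EReal) (f : ℝ → ℝ) : Prop :=
  (¬ ∃ c, RelMinB aE bE f c) ∨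
  ∃ c, RelMinB aE bE f c ∧ IbInt bE f c (mB bE f).toReal = ⊤

/-- Condition (A) at `a`. -/
def CondA_a (aE bE : EReal) (f : ℝ → ℝ) : Prop :=
  (¬ ∃ c, RelMinA aE bE f c) ∨
  ∃ c, RelMinA aE bE f c ∧ IaInt aE f c (mA aE f).toReal = ⊤

/-- Condition (A). -/
def CondA (aE bE : EReal) (f : ℝ → ℝ) : Prop :=
  CondA_a aE bE f ∧ CondA_b aE bE f

/-- `b^*(D) = inf {τ ∈ (c,b) | G τ = D}`, defaulting to `b` when the set is empty. -/
def bstar (bE : EReal) (f : ℝ → ℝ) (c D : ℝ) : EReal :=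
  sInf (insert bE ((fun τ : ℝ => (τ : EReal)) ''
    {τ : ℝ | c < τ ∧ (τ : EReal) < bE ∧ G f τ = D}))

/-- `a^*(D) = sup {τ ∈ (a,c) | G τ = D}`, defaulting to `a` when the set is empty. -/
def astar (aE : EReal) (f : ℝ → ℝ) (c D : ℝ) : EReal :=
  sSup (insert aE ((fun τ : ℝ => (τ : EReal)) ''
    {τ : ℝ | τ < c ∧ aE < (τ : EReal) ∧ G f τ = D}))

/-- `∫_c^{b^*(D)} f⁻²(G−D)^{-1/2}`. -/
def IbStar (bE : EReal) (f : ℝ → ℝ) (c D : ℝ) : ℝ≥0∞ :=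
  ∫⁻ τ in {τ : ℝ | c < τ ∧ (τ : EReal) < bstar bE f c D}, h f D τ

/-- `∫_{a^*(D)}^c f⁻²(G−D)^{-1/2}`. -/
def IaStar (aE : EReal) (f : ℝ → ℝ) (c D : ℝ) : ℝ≥0∞ :=
  ∫⁻ τ in {τ : ℝ | astar aE f c D < (τ : EReal) ∧ τ < c}, h f D τ

/-- `d_b`, computed with respect to the cut point `c`. -/
def dB (bE : EReal) (f : ℝ → ℝ) (c : ℝ) : ℝ≥0∞ :=
  limsup (fun D => IbStar bE f c D) (𝓝[>] (mB bE f).toReal) - IbInt bE f c (mB bE f).toReal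

/-- `d_a`, computed with respect to the cut point `c`. -/
def dA (aE : EReal) (f : ℝ → ℝ) (c : ℝ) : ℝ≥0∞ :=
  limsup (fun D => IaStar aE f c D) (𝓝[>] (mA aE f).toReal) - IaInt aE f c (mA aE f).toReal

/-- Condition (B) at `b`. -/
def CondB_b (aE bE : EReal) (f : ℝ → ℝ) (J : Set ℝ) : Prop :=
  CondA_b aE bE f ∨ ∃ c, RelMinB aE bE f c ∧ EMetric.diam J ≤ 2 * dB bE f c

/-- Condition (B) at `a`. -/
def CondB_a (aE bE : EReal) (f : ℝ → ℝ) (J : Set ℝ) : Prop :=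
  CondA_a aE bE f ∨ ∃ c, RelMinA aE bE f c ∧ EMetric.diam J ≤ 2 * dA aE f c

/-- Condition (B). -/
def CondB (aE bE : EReal) (f : ℝ → ℝ) (J : Set ℝ) : Prop :=
  CondB_a aE bE f J ∧ CondB_b aE bE f J

/-- `m = inf_{(a,b)} G`. -/
def mGlob (aE bE : EReal) (f : ℝ → ℝ) : ℝ := sInf (G f '' II aE bE)

/-- `α(D) = sup {τ ∈ (a,b) | G τ = D}`. -/
def alphaD (aE bE : EReal) (f : ℝ → ℝ) (D : ℝ) : EReal :=
  sSup ((fun τ : ℝ => (τ : EReal)) '' {τ : ℝ | τ ∈ II aE bE ∧ G f τ = D})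

/-- `β(D) = inf {τ ∈ (a,b) | G τ = D}`. -/
def betaD (aE bE : EReal) (f : ℝ → ℝ) (D : ℝ) : EReal :=
  sInf ((fun τ : ℝ => (τ : EReal)) '' {τ : ℝ | τ ∈ II aE bE ∧ G f τ = D})

/-- `i_b = inf_{D ∈ (m, m_b)} ∫_{α(D)}^b f⁻²(G−D)^{-1/2}`. -/
def iB (aE bE : EReal) (f : ℝ → ℝ) : ℝ≥0∞ :=
  ⨅ D ∈ Ioo (mGlob aE bE f) (mB bE f).toReal,
    ∫⁻ τ in {τ : ℝ | alphaD aE bE f D < (τ : EReal) ∧ (τ : EReal) < bE}, h f D τ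

/-- `i_a = inf_{D ∈ (m, m_a)} ∫_a^{β(D)} f⁻²(G−D)^{-1/2}`. -/
def iA (aE bE : EReal) (f : ℝ → ℝ) : ℝ≥0∞ :=
  ⨅ D ∈ Ioo (mGlob aE bE f) (mA aE f).toReal,
    ∫⁻ τ in {τ : ℝ | aE < (τ : EReal) ∧ (τ : EReal) < betaD aE bE f D}, h f D τ

/-- Condition (C) at `b`. -/
def CondC_b (aE bE : EReal) (f : ℝ → ℝ) (J : Set ℝ) : Prop :=
  CondB_b aE bE f J ∨
    ((mGlob aE bE f : EReal) < mB bE f ∧ ∃ c, RelMinB aE bE f c ∧ iB aE bE f ≤ dB bE f c)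

/-- Condition (C) at `a`. -/
def CondC_a (aE bE : EReal) (f : ℝ → ℝ) (J : Set ℝ) : Prop :=
  CondB_a aE bE f J ∨
    ((mGlob aE bE f : EReal) < mA aE f ∧ ∃ c, RelMinA aE bE f c ∧ iA aE bE f ≤ dA aE f c)

/-- Condition (C). -/
def CondC (aE bE : EReal) (f : ℝ → ℝ) (J : Set ℝ) : Prop :=
  CondC_a aE bE f J ∧ CondC_b aE bE f J

/-! ### Condition (R) -/

/-- `b^*(D) = inf {τ ∈ [τ0, b) | G τ = D}` (defaulting to `b`). -/
def bstarR (bE : EReal) (f : ℝ → ℝ) (τ0 D : ℝ) : EReal :=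
  sInf (insert bE ((fun τ : ℝ => (τ : EReal)) ''
    {τ : ℝ | τ0 ≤ τ ∧ (τ : EReal) < bE ∧ G f τ = D}))

/-- `a^*(D) = sup {τ ∈ (a, τ0] | G τ = D}` (defaulting to `a`). -/
def astarR (aE : EReal) (f : ℝ → ℝ) (τ0 D : ℝ) : EReal :=
  sSup (insert aE ((fun τ : ℝ => (τ : EReal)) ''
    {τ : ℝ | τ ≤ τ0 ∧ aE < (τ : EReal) ∧ G f τ = D}))

/-- `A(D) = ∫_{a^*(D)}^{τ0} h_D`. -/
def AInt (aE : EReal) (f : ℝ → ℝ) (τ0 D : ℝ) : ℝ≥0∞ :=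
  ∫⁻ τ in {τ : ℝ | astarR aE f τ0 D < (τ : EReal) ∧ τ < τ0}, h f D τ

/-- `B(D) = ∫_{τ0}^{b^*(D)} h_D`. -/
def BInt (bE : EReal) (f : ℝ → ℝ) (τ0 D : ℝ) : ℝ≥0∞ :=
  ∫⁻ τ in {τ : ℝ | τ0 < τ ∧ (τ : EReal) < bstarR bE f τ0 D}, h f D τ

/-- `T(D) = ∫_{a^*(D)}^{b^*(D)} h_D`. -/
def TInt (aE bE : EReal) (f : ℝ → ℝ) (τ0 D : ℝ) : ℝ≥0∞ :=
  ∫⁻ τ in {τ : ℝ | astarR aE f τ0 D < (τ : EReal) ∧ (τ : EReal) < bstarR bE f τ0 D},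
    h f D τ

/-- The point `b − ε` (replaced by `1/ε` when `b = ∞`). -/
def bEnd (bE : EReal) (ε : ℝ) : ℝ := if bE = ⊤ then ε⁻¹ else bE.toReal - ε

/-- The point `a + ε` (replaced by `−1/ε` when `a = −∞`). -/
def aEnd (aE : EReal) (ε : ℝ) : ℝ := if aE = ⊥ then -ε⁻¹ else aE.toReal + ε

/-- The oriented integral `Q(D,ε) = ∫_{b−ε}^{b^*(D)} h_D`, valued in `[−∞,∞]`. -/
def QInt (bE : EReal) (f : ℝ → ℝ) (τ0 D ε : ℝ) : EReal :=
  if ((bEnd bE ε : ℝ) : EReal) ≤ bstarR bE f τ0 D then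
    ((∫⁻ τ in {τ : ℝ | bEnd bE ε < τ ∧ (τ : EReal) < bstarR bE f τ0 D}, h f D τ : ℝ≥0∞) :
      EReal)
  else
    -((∫⁻ τ in {τ : ℝ | bstarR bE f τ0 D < (τ : EReal) ∧ τ < bEnd bE ε}, h f D τ : ℝ≥0∞) :
      EReal)

/-- The oriented integral `Q'(D,ε) = ∫_{a^*(D)}^{a+ε} h_D`, valued in `[−∞,∞]`. -/
def QInt' (aE : EReal) (f : ℝ → ℝ) (τ0 D ε : ℝ) : EReal :=
  if astarR aE f τ0 D ≤ ((aEnd aE ε : ℝ) : EReal) then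
    ((∫⁻ τ in {τ : ℝ | astarR aE f τ0 D < (τ : EReal) ∧ τ < aEnd aE ε}, h f D τ : ℝ≥0∞) :
      EReal)
  else
    -((∫⁻ τ in {τ : ℝ | aEnd aE ε < τ ∧ (τ : EReal) < astarR aE f τ0 D}, h f D τ : ℝ≥0∞) :
      EReal)

/-- `C_n(D)`: `B(D)` for even `n`, `A(D)` for odd `n`. -/
def CInt (aE bE : EReal) (f : ℝ → ℝ) (τ0 : ℝ) (n : ℕ) (D : ℝ) : ℝ≥0∞ :=
  if Even n then BInt bE f τ0 D else AInt aE f τ0 D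

/-- `C'_n(D)`: `A(D)` for even `n`, `B(D)` for odd `n`. -/
def CInt' (aE bE : EReal) (f : ℝ → ℝ) (τ0 : ℝ) (n : ℕ) (D : ℝ) : ℝ≥0∞ :=
  if Even n then AInt aE f τ0 D else BInt bE f τ0 D

/-- `r_i^n(τ0) = lim_{ε↘0} liminf_{D↘m} (C_n(D) + n·T(D) − Q(D,ε))`; since the inner
quantity is nonincreasing in `ε`, the limit as `ε ↘ 0` is the supremum over `ε > 0`. -/
def rI (aE bE : EReal) (f : ℝ → ℝ) (τ0 : ℝ) (n : ℕ) : EReal :=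
  ⨆ ε : {e : ℝ // 0 < e},
    liminf (fun D =>
        ((CInt aE bE f τ0 n D + n * TInt aE bE f τ0 D : ℝ≥0∞) : EReal)
          - QInt bE f τ0 D ε.1)
      (𝓝[>] (mGlob aE bE f))

/-- `r_s^n(τ0) = lim_{ε↘0} limsup_{D↘m} (C_n(D) + n·T(D) + Q(D,ε))`. -/
def rS (aE bE : EReal) (f : ℝ → ℝ) (τ0 : ℝ) (n : ℕ) : EReal :=
  ⨅ ε : {e : ℝ // 0 < e},
    limsup (fun D =>
        ((CInt aE bE f τ0 n D + n * TInt aE bE f τ0 D : ℝ≥0∞) : EReal)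
          + QInt bE f τ0 D ε.1)
      (𝓝[>] (mGlob aE bE f))

/-- `l_i^n(τ0) = lim_{ε↘0} liminf_{D↘m} (C'_n(D) + n·T(D) − Q'(D,ε))`. -/
def lI (aE bE : EReal) (f : ℝ → ℝ) (τ0 : ℝ) (n : ℕ) : EReal :=
  ⨆ ε : {e : ℝ // 0 < e},
    liminf (fun D =>
        ((CInt' aE bE f τ0 n D + n * TInt aE bE f τ0 D : ℝ≥0∞) : EReal)
          - QInt' aE f τ0 D ε.1)
      (𝓝[>] (mGlob aE bE f))

/-- `l_s^n(τ0) = lim_{ε↘0} limsup_{D↘m} (C'_n(D) + n·T(D) + Q'(D,ε))`. -/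
def lS (aE bE : EReal) (f : ℝ → ℝ) (τ0 : ℝ) (n : ℕ) : EReal :=
  ⨅ ε : {e : ℝ // 0 < e},
    limsup (fun D =>
        ((CInt' aE bE f τ0 n D + n * TInt aE bE f τ0 D : ℝ≥0∞) : EReal)
          + QInt' aE f τ0 D ε.1)
      (𝓝[>] (mGlob aE bE f))

/-- Condition (R). -/
def CondR (aE bE : EReal) (f : ℝ → ℝ) (J : Set ℝ) : Prop :=
  (∀ τ ∈ II aE bE, mGlob aE bE f < G f τ) ∧
  mA aE f = (mGlob aE bE f : EReal) ∧ mB bE f = (mGlob aE bE f : EReal) ∧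
  ∀ τ0 ∈ II aE bE,
    (Icc (rI aE bE f τ0 0) ((EMetric.diam J : ℝ≥0∞) : EReal) ⊆
        ⋃ n : ℕ, Icc (rI aE bE f τ0 n) (rS aE bE f τ0 n)) ∧
    (Icc (lI aE bE f τ0 0) ((EMetric.diam J : ℝ≥0∞) : EReal) ⊆
        ⋃ n : ℕ, Icc (lI aE bE f τ0 n) (lS aE bE f τ0 n))

end GRW

open Set Filter MeasureTheory Topology GRW
open scoped ENNReal

namespace GC

def hh (V : ℝ → ℝ) (D τ : ℝ) : ℝ≥0∞ :=
  ENNReal.ofReal (V τ) * (ENNReal.ofReal (√(V τ - D)))⁻¹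

structure Dat (I : Set ℝ) (V : ℝ → ℝ) : Prop where
  opn : IsOpen I
  ord : OrdConnected I
  smooth : ContDiffOn ℝ 2 V I
  pos : ∀ τ ∈ I, 0 < V τ

def Flow (I : Set ℝ) (V : ℝ → ℝ) (p q : ℝ × ℝ) (L : ℝ) : Prop :=
  ∃ (t1 : ℝ) (σ w x : ℝ → ℝ), 0 ≤ t1 ∧ σ 0 = p.1 ∧ w 0 = p.2 ∧ x 0 = 0 ∧
    σ t1 = q.1 ∧ w t1 = q.2 ∧ x t1 = L ∧
    ∀ t ∈ Icc 0 t1, σ t ∈ I ∧ HasDerivWithinAt σ (w t) (Icc 0 t1) t ∧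
      HasDerivWithinAt w (deriv V (σ t) / 2) (Icc 0 t1) t ∧
      HasDerivWithinAt x (V (σ t)) (Icc 0 t1) t

def glue (s : ℝ) (u v : ℝ → ℝ) (t : ℝ) : ℝ := if t ≤ s then u t else v (t - s)

lemma glue_deriv {s r : ℝ} (hs : 0 ≤ s) (hr : 0 ≤ r) {u v u' v' : ℝ → ℝ}
    (hu : ∀ t ∈ Icc 0 s, HasDerivWithinAt u (u' t) (Icc 0 s) t)
    (hv : ∀ t ∈ Icc 0 r, HasDerivWithinAt v (v' t) (Icc 0 r) t)
    (h0 : u s = v 0) (h1 : u' s = v' 0) :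
    ∀ t ∈ Icc 0 (s + r), HasDerivWithinAt (glue s u v) (glue s u' v' t) (Icc 0 (s + r)) t := by
  have key : ∀ t ∈ Icc 0 r, HasDerivWithinAt (fun t => v (t - s)) (v' t) (Icc s (s + r)) (t + s) := by
    intro t ht
    have := hv t ht
    have h2 : HasDerivWithinAt (fun t : ℝ => t - s) 1 (Icc s (s + r)) (t + s) :=
      ((hasDerivAt_id _).sub_const s).hasDerivWithinAt
    have h3 : HasDerivWithinAt v (v' t) (Icc 0 r) ((fun t : ℝ => t - s) (t + s)) := by
      simpa using this
    have h4 := h3.comp (t + s) h2 (by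
      intro y hy
      simp only [mem_Icc] at hy ⊢
      constructor <;> linarith [hy.1, hy.2])
    simp only [mul_one] at h4
    exact h4
  have gu : ∀ t ∈ Icc 0 s, glue s u v t = u t := fun t ht => by
    simp [glue, ht.2]
  have gv : ∀ t ∈ Icc s (s + r), glue s u v t = v (t - s) := fun t ht => by
    unfold glue
    split_ifs with h
    · have : t = s := le_antisymm h ht.1
      subst this; simp [h0]
    · rfl
  have hun : Icc 0 (s + r) = Icc 0 s ∪ Icc s (s + r) := by
    rw [Icc_union_Icc_eq_Icc hs (by linarith)]
  have left : ∀ t ∈ Icc 0 s, HasDerivWithinAt (glue s u v) (u' t) (Icc 0 s) t := fun t ht =>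
    (hu t ht).congr gu (gu t ht)
  have right : ∀ t ∈ Icc s (s + r),
      HasDerivWithinAt (glue s u v) (v' (t - s)) (Icc s (s + r)) t := fun t ht => by
    have := key (t - s) ⟨by linarith [ht.1], by linarith [ht.2]⟩
    rw [sub_add_cancel] at this
    exact this.congr gv (gv t ht)
  intro t ht
  rw [hun]
  rcases lt_trichotomy t s with h | h | h
  · have : glue s u' v' t = u' t := by simp [glue, h.le]
    rw [this]
    refine (left t ⟨ht.1, h.le⟩).union ?_
    refine HasFDerivWithinAt.of_notMem_closure ?_
    rw [closure_Icc]
    exact fun hh => absurd hh.1 (not_le.mpr h)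
  · subst h
    have : glue t u' v' t = u' t := by simp [glue]
    rw [this]
    refine (left t ⟨ht.1, le_rfl⟩).union ?_
    have := right t ⟨le_rfl, by linarith⟩
    rwa [sub_self, ← h1] at this
  · have : glue s u' v' t = v' (t - s) := by simp [glue, h]
    rw [this]
    refine HasDerivWithinAt.union ?_ (right t ⟨h.le, ht.2⟩)
    refine HasFDerivWithinAt.of_notMem_closure ?_
    rw [closure_Icc]
    exact fun hh => absurd hh.2 (not_le.mpr h)

lemma Flow.refl {I : Set ℝ} {V : ℝ → ℝ} {p : ℝ × ℝ} (hp : p.1 ∈ I) : Flow I V p p 0 := by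
  refine ⟨0, fun _ => p.1, fun _ => p.2, fun _ => 0, le_rfl, rfl, rfl, rfl, rfl, rfl, rfl, ?_⟩
  intro t ht
  have : t = 0 := le_antisymm ht.2 ht.1
  subst this
  have hs : (Icc (0 : ℝ) 0).Subsingleton := by simp
  exact ⟨hp, HasFDerivWithinAt.of_subsingleton hs, HasFDerivWithinAt.of_subsingleton hs,
    HasFDerivWithinAt.of_subsingleton hs⟩

lemma Flow.trans {I : Set ℝ} {V : ℝ → ℝ} {p q r : ℝ × ℝ} {L M : ℝ}
    (h : Flow I V p q L) (h' : Flow I V q r M) : Flow I V p r (L + M) := by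
  obtain ⟨s, σ, w, x, hs, a1, a2, a3, a4, a5, a6, H⟩ := h
  obtain ⟨s', σ', w', x', hs', b1, b2, b3, b4, b5, b6, H'⟩ := h'
  have e : ∀ u v : ℝ → ℝ, u s = v 0 → glue s u v (s + s') = v s' := by
    intro u v huv
    unfold glue
    split_ifs with hc
    · have : s' = 0 := by linarith
      subst this; simp [huv]
    · congr 1; ring
  have e0 : ∀ u v : ℝ → ℝ, glue s u v 0 = u 0 := by
    intro u v; simp [glue, hs]
  refine ⟨s + s', glue s σ σ', glue s w w', glue s x (fun t => x' t + L), by linarith, ?_, ?_, ?_,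
    ?_, ?_, ?_, ?_⟩
  · rw [e0, a1]
  · rw [e0, a2]
  · rw [e0, a3]
  · rw [e _ _ (by rw [a4, b1]), b4]
  · rw [e _ _ (by rw [a5, b2]), b5]
  · rw [e _ _ (by simp [a6, b3]), b6]; ring
  · intro t ht
    refine ⟨?_, ?_, ?_, ?_⟩
    · unfold glue
      split_ifs with hc
      · exact (H t ⟨ht.1, hc⟩).1
      · exact (H' (t - s) ⟨by linarith, by linarith [ht.2]⟩).1
    · exact glue_deriv hs hs' (fun t ht => (H t ht).2.1) (fun t ht => (H' t ht).2.1)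
        (by rw [a4, b1]) (by rw [a5, b2]) t ht
    · have := glue_deriv hs hs' (fun t ht => (H t ht).2.2.1) (fun t ht => (H' t ht).2.2.1)
        (by rw [a5, b2]) (by simp only [a4, b1]) t ht
      convert this using 1
      unfold glue; split_ifs <;> rfl
    · have := glue_deriv hs hs' (fun t ht => (H t ht).2.2.2)
        (fun t ht => (H' t ht).2.2.2.add_const L)
        (by simp [a6, b3]) (by simp only [a4, b1]) t ht
      convert this using 1
      unfold glue; split_ifs <;> rfl

lemma rev_deriv {s : ℝ} {u u' : ℝ → ℝ}
    (hu : ∀ t ∈ Icc 0 s, HasDerivWithinAt u (u' t) (Icc 0 s) t) :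
    ∀ t ∈ Icc 0 s, HasDerivWithinAt (fun t => u (s - t)) (-(u' (s - t))) (Icc 0 s) t := by
  intro t ht
  have h1 := hu (s - t) ⟨by linarith [ht.2], by linarith [ht.1]⟩
  have h2 : HasDerivWithinAt (fun t : ℝ => s - t) (-1) (Icc 0 s) t :=
    ((hasDerivAt_id t).const_sub s).hasDerivWithinAt
  have h4 := HasDerivWithinAt.comp (h₂ := u) t h1 h2 (by
      intro y hy
      simp only [mem_Icc] at hy ⊢
      constructor <;> linarith [hy.1, hy.2])
  rw [mul_neg_one] at h4
  exact h4

lemma Flow.rev {I : Set ℝ} {V : ℝ → ℝ} {p q : ℝ × ℝ} {L : ℝ}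
    (h : Flow I V p q L) : Flow I V (q.1, -q.2) (p.1, -p.2) L := by
  obtain ⟨s, σ, w, x, hs, a1, a2, a3, a4, a5, a6, H⟩ := h
  refine ⟨s, fun t => σ (s - t), fun t => - w (s - t), fun t => L - x (s - t), hs, by simp [a4],
    by simp [a5], by simp [a6], by simp [a1], by simp [a2], by simp [a3], ?_⟩
  intro t ht
  have ht' : s - t ∈ Icc 0 s := ⟨by linarith [ht.2], by linarith [ht.1]⟩
  refine ⟨(H _ ht').1, rev_deriv (fun t ht => (H t ht).2.1) t ht, ?_, ?_⟩
  · have := (rev_deriv (fun t ht => (H t ht).2.2.1) t ht).neg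
    rw [neg_neg] at this
    exact this
  · have := (rev_deriv (fun t ht => (H t ht).2.2.2) t ht).const_sub L
    rw [neg_neg] at this
    exact this

lemma Flow.neg {I : Set ℝ} {V : ℝ → ℝ} {p q : ℝ × ℝ} {L : ℝ}
    (h : Flow I V p q L) :
    Flow (Neg.neg ⁻¹' I) (fun t => V (-t)) (-p.1, -p.2) (-q.1, -q.2) L := by
  obtain ⟨s, σ, w, x, hs, a1, a2, a3, a4, a5, a6, H⟩ := h
  refine ⟨s, fun t => -σ t, fun t => - w t, x, hs, by simp [a1], by simp [a2], a3, by simp [a4],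
    by simp [a5], a6, ?_⟩
  intro t ht
  refine ⟨by simpa using (H t ht).1, (H t ht).2.1.neg, ?_, ?_⟩
  · have := (H t ht).2.2.1.neg
    rw [deriv_comp_neg, neg_neg, neg_div]
    exact this
  · simpa using (H t ht).2.2.2

lemma Flow.const {I : Set ℝ} {V : ℝ → ℝ} {τ : ℝ} {L : ℝ} (hτ : τ ∈ I) (h : deriv V τ = 0)
    (hV : 0 < V τ) (hL : 0 ≤ L) : Flow I V (τ, 0) (τ, 0) L := by
  refine ⟨L / V τ, fun _ => τ, fun _ => 0, fun t => t * V τ, by positivity, rfl, rfl, by simp,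
    rfl, rfl, by field_simp, ?_⟩
  intro t ht
  refine ⟨hτ, hasDerivWithinAt_const _ _ _, ?_, ?_⟩
  · simpa [h] using hasDerivWithinAt_const t (Icc 0 (L / V τ)) (0 : ℝ)
  · simpa using ((hasDerivAt_id t).mul_const (V τ)).hasDerivWithinAt

lemma deriv_ext {s : ℝ} (hs : 0 < s) {u u' : ℝ → ℝ} (hc : ContinuousOn u (Icc 0 s))
    (hc' : ContinuousOn u' (Icc 0 s)) (hd : ∀ t ∈ Ioo 0 s, HasDerivAt u (u' t) t) :
    ∀ t ∈ Icc 0 s, HasDerivWithinAt u (u' t) (Icc 0 s) t := by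
  intro t ht
  have hdiff : DifferentiableOn ℝ u (Ioo 0 s) :=
    fun t ht => (hd t ht).differentiableAt.differentiableWithinAt
  rcases eq_or_lt_of_le ht.1 with h | h
  · subst h
    refine (hasDerivWithinAt_Ici_of_tendsto_deriv hdiff ((hc 0 ht).mono Ioo_subset_Icc_self)
      (Ioo_mem_nhdsGT hs) ?_).mono Icc_subset_Ici_self
    have h1 : Tendsto u' (𝓝[>] 0) (𝓝 (u' 0)) := by
      have := (hc' 0 ht).mono Ioo_subset_Icc_self
      rwa [ContinuousWithinAt, nhdsWithin_Ioo_eq_nhdsGT hs] at this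
    refine h1.congr' ?_
    filter_upwards [Ioo_mem_nhdsGT hs] with y hy using (hd y hy).deriv.symm
  rcases eq_or_lt_of_le ht.2 with h' | h'
  · subst h'
    refine (hasDerivWithinAt_Iic_of_tendsto_deriv hdiff ((hc t ht).mono Ioo_subset_Icc_self)
      (Ioo_mem_nhdsLT hs) ?_).mono Icc_subset_Iic_self
    have h1 : Tendsto u' (𝓝[<] t) (𝓝 (u' t)) := by
      have := (hc' t ht).mono Ioo_subset_Icc_self
      rwa [ContinuousWithinAt, nhdsWithin_Ioo_eq_nhdsLT hs] at this
    refine h1.congr' ?_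
    filter_upwards [Ioo_mem_nhdsLT hs] with y hy using (hd y hy).deriv.symm
  · exact (hd t ⟨h, h'⟩).hasDerivWithinAt

end GC

namespace GC

lemma hh_eq {V : ℝ → ℝ} {D τ : ℝ} (h0 : 0 ≤ V τ) (h : D < V τ) :
    hh V D τ = ENNReal.ofReal (V τ * (√(V τ - D))⁻¹) := by
  have : 0 < √(V τ - D) := Real.sqrt_pos.mpr (by linarith)
  rw [hh, ENNReal.ofReal_mul h0, ENNReal.ofReal_inv_of_pos this]

lemma Dat.cont {I : Set ℝ} {V : ℝ → ℝ} (hd : Dat I V) : ContinuousOn V I := hd.smooth.continuousOn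

lemma Dat.hasDeriv {I : Set ℝ} {V : ℝ → ℝ} (hd : Dat I V) {τ : ℝ} (h : τ ∈ I) :
    HasDerivAt V (deriv V τ) τ :=
  ((hd.smooth.differentiableOn (by norm_num) τ h).differentiableAt
    (hd.opn.mem_nhds h)).hasDerivAt

lemma Dat.contDeriv {I : Set ℝ} {V : ℝ → ℝ} (hd : Dat I V) : ContinuousOn (deriv V) I :=
  hd.smooth.continuousOn_deriv_of_isOpen hd.opn (by norm_num)

lemma exists_min {I : Set ℝ} {V : ℝ → ℝ} (hd : Dat I V) {c d : ℝ} (hcd : c ≤ d)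
    (hI : Icc c d ⊆ I) : ∃ z ∈ Icc c d, ∀ τ ∈ Icc c d, V z ≤ V τ :=
  isCompact_Icc.exists_isMinOn (nonempty_Icc.mpr hcd) (hd.cont.mono hI)

lemma exists_maxV {I : Set ℝ} {V : ℝ → ℝ} (hd : Dat I V) {c d : ℝ} (hcd : c ≤ d)
    (hI : Icc c d ⊆ I) : ∃ z ∈ Icc c d, ∀ τ ∈ Icc c d, V τ ≤ V z :=
  isCompact_Icc.exists_isMaxOn (nonempty_Icc.mpr hcd) (hd.cont.mono hI)

lemma cont_k {I : Set ℝ} {V : ℝ → ℝ} (hd : Dat I V) {c d D : ℝ}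
    (hI : Icc c d ⊆ I) (hD : ∀ τ ∈ Ioo c d, D < V τ) :
    ContinuousOn (fun τ => (√(V τ - D))⁻¹) (Ioo c d) := by
  have h1 : ContinuousOn V (Ioo c d) := hd.cont.mono (Ioo_subset_Icc_self.trans hI)
  refine ContinuousOn.inv₀ (by fun_prop) ?_
  intro τ hτ
  exact (Real.sqrt_pos.mpr (by linarith [hD τ hτ])).ne'

lemma Flow.base {I : Set ℝ} {V : ℝ → ℝ} (hd : Dat I V) {c d D : ℝ} (hcd : c < d)
    (hI : Icc c d ⊆ I) (hD : ∀ τ ∈ Ioo c d, D < V τ)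
    (hfin : ∫⁻ τ in Ioo c d, hh V D τ ≠ ∞) :
    Flow I V (c, √(V c - D)) (d, √(V d - D)) (∫⁻ τ in Ioo c d, hh V D τ).toReal := by
  set r : ℝ → ℝ := fun τ => (√(V τ - D))⁻¹ with hr
  have hVc : ContinuousOn V (Ioo c d) := hd.cont.mono (Ioo_subset_Icc_self.trans hI)
  have hrc : ContinuousOn r (Ioo c d) := cont_k hd hI hD
  have hrpos : ∀ τ ∈ Ioo c d, 0 < r τ := fun τ hτ => by
    have := hD τ hτ
    have : 0 < √(V τ - D) := Real.sqrt_pos.mpr (by linarith)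
    simp only [hr]; positivity
  have hVpos : ∀ τ ∈ Icc c d, 0 < V τ := fun τ hτ => hd.pos τ (hI hτ)
  set k : ℝ → ℝ := fun τ => V τ * r τ with hk
  have hkc : ContinuousOn k (Ioo c d) := hVc.mul hrc
  have hkpos : ∀ τ ∈ Ioo c d, 0 < k τ := fun τ hτ =>
    mul_pos (hVpos τ (Ioo_subset_Icc_self hτ)) (hrpos τ hτ)
  have hlin : ∫⁻ τ in Ioo c d, hh V D τ = ∫⁻ τ in Ioo c d, ENNReal.ofReal (k τ) :=
    setLIntegral_congr_fun measurableSet_Ioo (fun τ hτ =>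
      hh_eq (hVpos τ (Ioo_subset_Icc_self hτ)).le (hD τ hτ))
  have hkint : IntegrableOn k (Ioo c d) := by
    refine ⟨hkc.aestronglyMeasurable measurableSet_Ioo, ?_⟩
    rw [hasFiniteIntegral_iff_ofReal]
    · rw [← hlin]; exact hfin.lt_top
    · exact (ae_restrict_iff' measurableSet_Ioo).mpr (ae_of_all _ fun τ hτ => (hkpos τ hτ).le)
  have hkval : (∫⁻ τ in Ioo c d, hh V D τ).toReal = ∫ τ in c..d, k τ := by
    rw [intervalIntegral.integral_of_le hcd.le, integral_Ioc_eq_integral_Ioo, hlin,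
      integral_eq_lintegral_of_nonneg_ae]
    · exact (ae_restrict_iff' measurableSet_Ioo).mpr (ae_of_all _ fun τ hτ => (hkpos τ hτ).le)
    · exact hkc.aestronglyMeasurable measurableSet_Ioo
  have hrint : IntegrableOn r (Ioo c d) := by
    obtain ⟨z, hz, hz'⟩ := exists_min hd hcd.le hI
    have hzp := hVpos z hz
    refine Integrable.mono' (hkint.const_mul (V z)⁻¹) (hrc.aestronglyMeasurable measurableSet_Ioo) ?_
    refine (ae_restrict_iff' measurableSet_Ioo).mpr (ae_of_all _ fun τ hτ => ?_)
    have h1 := hrpos τ hτ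
    rw [Real.norm_of_nonneg h1.le]
    have h2 := hz' τ (Ioo_subset_Icc_self hτ)
    calc r τ = (V z)⁻¹ * (V z * r τ) := by field_simp
      _ ≤ (V z)⁻¹ * (V τ * r τ) := by gcongr
  set ρ : ℝ → ℝ := fun τ => (Ioo c d).indicator r τ + (Ioo c d)ᶜ.indicator (fun _ => 1) τ with hρ
  have hρint : ∀ p q, IntervalIntegrable ρ volume p q := by
    intro p q
    refine IntervalIntegrable.add ?_ ?_
    · exact (hrint.integrable_indicator measurableSet_Ioo).intervalIntegrable
    · rw [intervalIntegrable_iff]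
      exact (integrableOn_const (by simp)).indicator measurableSet_Ioo.compl
  have hρin : ∀ τ ∈ Ioo c d, ρ τ = r τ := fun τ hτ => by simp only [hρ]; simp [hτ]
  have hρout : ∀ τ, τ ∉ Ioo c d → ρ τ = 1 := fun τ hτ => by
    simp only [hρ]; rw [indicator_of_notMem hτ, indicator_of_mem hτ, zero_add]
  have hρpos : ∀ τ, 0 < ρ τ := fun τ => by
    by_cases h : τ ∈ Ioo c d
    · rw [hρin τ h]; exact hrpos τ h
    · rw [hρout τ h]; norm_num
  set T : ℝ → ℝ := fun τ => ∫ s in c..τ, ρ s with hT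
  have hTc : Continuous T := intervalIntegral.continuous_primitive hρint c
  have hTdiff : ∀ p q, T q - T p = ∫ s in p..q, ρ s := fun p q =>
    intervalIntegral.integral_interval_sub_left (hρint _ _) (hρint _ _)
  have hTm : StrictMono T := by
    intro p q hpq
    have := intervalIntegral.intervalIntegral_pos_of_pos (hρint p q) hρpos hpq
    linarith [hTdiff p q]
  have hone : ∀ p q, (∀ s ∈ uIoc p q, s ∉ Ioo c d) → T q - T p = q - p := by
    intro p q h
    rw [hTdiff, intervalIntegral.integral_congr_ae (g := fun _ => (1 : ℝ))]
    · simp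
    · exact ae_of_all _ fun s hs => hρout s (h s hs)
  have hTs : Function.Surjective T := by
    refine hTc.surjective ?_ ?_
    · refine tendsto_atTop_mono' atTop (f₁ := fun q => T d + (q - d)) ?_ ?_
      · filter_upwards [eventually_ge_atTop d] with q hq
        have := hone d q (fun s hs h => by rw [uIoc_of_le hq] at hs; linarith [hs.1, h.2])
        linarith
      · exact tendsto_atTop_add_const_left _ _ (tendsto_atTop_add_const_right _ _ tendsto_id)
    · refine tendsto_atBot_mono' atBot (f₁ := fun q => T c + (q - c)) ?_ ?_
      · filter_upwards [eventually_le_atBot c] with q hq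
        have := hone c q (fun s hs h => by rw [uIoc_of_ge hq] at hs; linarith [hs.2, h.1])
        linarith
      · exact tendsto_atBot_add_const_left _ _ (tendsto_atBot_add_const_right _ _ tendsto_id)
  let e : ℝ ≃o ℝ := hTm.orderIsoOfSurjective T hTs
  have heT : ∀ y, e y = T y := fun y => rfl
  set σ : ℝ → ℝ := fun t => e.symm t with hσ
  have hσc : Continuous σ := e.symm.continuous
  have hTσ : ∀ t, T (σ t) = t := fun t => by rw [← heT]; exact e.apply_symm_apply t
  have hσT : ∀ t, σ (T t) = t := fun t => by rw [← heT]; exact e.symm_apply_apply t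
  have hσm : StrictMono σ := e.symm.strictMono
  have hT0 : T c = 0 := by simp [hT]
  set t1 := T d with ht1
  have ht1pos : 0 < t1 := by rw [← hT0]; exact hTm hcd
  have hσ0 : σ 0 = c := by rw [← hT0, hσT]
  have hσ1 : σ t1 = d := hσT d
  have hσIoo : ∀ t ∈ Ioo 0 t1, σ t ∈ Ioo c d := fun t ht => by
    rw [← hσ0, ← hσ1]; exact ⟨hσm ht.1, hσm ht.2⟩
  have hσIcc : ∀ t ∈ Icc 0 t1, σ t ∈ Icc c d := fun t ht => by
    rw [← hσ0, ← hσ1]; exact ⟨hσm.monotone ht.1, hσm.monotone ht.2⟩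
  have hσd : ∀ t ∈ Ioo 0 t1, HasDerivAt σ (√(V (σ t) - D)) t := by
    intro t ht
    have hm := hσIoo t ht
    have hnh : Ioo c d ∈ 𝓝 (σ t) := isOpen_Ioo.mem_nhds hm
    have hev : ρ =ᶠ[𝓝 (σ t)] r := by filter_upwards [hnh] with y hy using hρin y hy
    have h1 : HasDerivAt T (ρ (σ t)) (σ t) := by
      refine intervalIntegral.integral_hasDerivAt_right (hρint _ _) ?_ ?_
      · refine ⟨Ioo c d, hnh, ?_⟩
        exact (hrc.congr (fun y hy => hρin y hy)).aestronglyMeasurable measurableSet_Ioo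
      · exact (hrc.continuousAt hnh).congr hev.symm
    rw [hρin _ hm] at h1
    have := HasDerivAt.of_local_left_inverse hσc.continuousAt h1 (hrpos _ hm).ne'
      (Eventually.of_forall hTσ)
    simpa [hr] using this
  have hwc : ContinuousOn (fun t => √(V (σ t) - D)) (Icc 0 t1) := by
    have : ContinuousOn (fun t => V (σ t)) (Icc 0 t1) :=
      hd.cont.comp hσc.continuousOn (fun t ht => hI (hσIcc t ht))
    exact (this.sub continuousOn_const).sqrt
  have hVσc : ContinuousOn (fun t => V (σ t)) (Icc 0 t1) :=
      hd.cont.comp hσc.continuousOn (fun t ht => hI (hσIcc t ht))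
  have hkI : IntervalIntegrable k volume c d := by
    rw [intervalIntegrable_iff_integrableOn_Ioo_of_le hcd.le]; exact hkint
  have hX : ContinuousOn (fun τ => ∫ s in c..τ, k s) (Icc c d) := by
    have := intervalIntegral.continuousOn_primitive_interval (f := k) (a := c) (b := d) (μ := volume)
      (by rw [uIcc_of_le hcd.le, integrableOn_Icc_iff_integrableOn_Ioo]; exact hkint)
    rwa [uIcc_of_le hcd.le] at this
  refine ⟨t1, σ, fun t => √(V (σ t) - D), fun t => ∫ s in c..σ t, k s, ht1pos.le, hσ0,
    by simp only [hσ0], by simp only [hσ0, intervalIntegral.integral_same], hσ1,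
    by simp only [hσ1], by simp only [hσ1, hkval], ?_⟩
  intro t ht
  refine ⟨hI (hσIcc t ht), deriv_ext ht1pos hσc.continuousOn hwc hσd t ht, ?_, ?_⟩
  · refine deriv_ext (u' := fun t => deriv V (σ t) / 2) ht1pos hwc ?_ ?_ t ht
    · exact (hd.contDeriv.comp hσc.continuousOn (fun t ht => hI (hσIcc t ht))).div_const 2
    · intro t ht
      have hm := hσIoo t ht
      have hp : 0 < V (σ t) - D := by linarith [hD _ hm]
      have h1 := (hd.hasDeriv (hI (Ioo_subset_Icc_self hm))).comp t (hσd t ht)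
      have h2 := (h1.sub_const D).sqrt hp.ne'
      refine h2.congr_deriv ?_
      have : √(V (σ t) - D) ≠ 0 := (Real.sqrt_pos.mpr hp).ne'
      simp only [Function.comp]
      field_simp
  · refine deriv_ext (u' := fun t => V (σ t)) ht1pos
      (hX.comp hσc.continuousOn (fun t ht => hσIcc t ht)) hVσc ?_ t ht
    intro t ht
    have hm := hσIoo t ht
    have hp : 0 < V (σ t) - D := by linarith [hD _ hm]
    have hnh : Ioo c d ∈ 𝓝 (σ t) := isOpen_Ioo.mem_nhds hm
    have h1 : HasDerivAt (fun τ => ∫ s in c..τ, k s) (k (σ t)) (σ t) := by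
      refine intervalIntegral.integral_hasDerivAt_right
        (hkI.mono_set ?_) ⟨Ioo c d, hnh, hkc.aestronglyMeasurable measurableSet_Ioo⟩
        (hkc.continuousAt hnh)
      rw [uIcc_of_le hcd.le, uIcc_of_le hm.1.le]
      exact Icc_subset_Icc_right hm.2.le
    have h2 := h1.comp t (hσd t ht)
    refine h2.congr_deriv ?_
    have : √(V (σ t) - D) ≠ 0 := (Real.sqrt_pos.mpr hp).ne'
    simp only [hk, hr]
    field_simp

end GC

namespace GC

def FlowE (I : Set ℝ) (V : ℝ → ℝ) (p q : ℝ × ℝ) (l : ℝ≥0∞) : Prop :=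
  l ≠ ∞ → Flow I V p q l.toReal

lemma FlowE.trans {I : Set ℝ} {V : ℝ → ℝ} {p q r : ℝ × ℝ} {l k : ℝ≥0∞}
    (h : FlowE I V p q l) (h' : FlowE I V q r k) : FlowE I V p r (l + k) := by
  intro hlk
  rw [ENNReal.add_ne_top] at hlk
  rw [ENNReal.toReal_add hlk.1 hlk.2]
  exact (h hlk.1).trans (h' hlk.2)

lemma FlowE.refl {I : Set ℝ} {V : ℝ → ℝ} {p : ℝ × ℝ} (hp : p.1 ∈ I) : FlowE I V p p 0 := by
  intro _; simpa using Flow.refl hp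

lemma FlowE.rev {I : Set ℝ} {V : ℝ → ℝ} {p q : ℝ × ℝ} {l : ℝ≥0∞}
    (h : FlowE I V p q l) : FlowE I V (q.1, -q.2) (p.1, -p.2) l := fun hl => (h hl).rev

lemma FlowE.iter {I : Set ℝ} {V : ℝ → ℝ} {p : ℝ × ℝ} {l : ℝ≥0∞} (hp : p.1 ∈ I)
    (h : FlowE I V p p l) (n : ℕ) : FlowE I V p p (n • l) := by
  induction n with
  | zero => simpa using FlowE.refl hp
  | succ n ih => rw [succ_nsmul]; exact ih.trans h

lemma FlowE.up {I : Set ℝ} {V : ℝ → ℝ} (hd : Dat I V) {p q D : ℝ} (hpq : p ≤ q)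
    (hI : Icc p q ⊆ I) (hD : ∀ τ ∈ Ioo p q, D < V τ) :
    FlowE I V (p, √(V p - D)) (q, √(V q - D)) (∫⁻ τ in Ioo p q, hh V D τ) := by
  rcases eq_or_lt_of_le hpq with h | h
  · subst h
    simpa using FlowE.refl (p := (p, √(V p - D))) (hI ⟨le_rfl, le_rfl⟩)
  · exact fun hf => Flow.base hd h hI hD hf

def Fm (n : ℕ) (A K E : ℝ≥0∞) : ℝ≥0∞ :=
  (if Even n then 0 else A + A) + (n / 2) • ((A + K + E) + (A + K + E)) + K

lemma reach {I : Set ℝ} {V : ℝ → ℝ} (hd : Dat I V) {α τ τ' β D : ℝ} (h1 : α ≤ τ) (h2 : τ ≤ τ')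
    (h3 : τ' ≤ β) (hI : Icc α β ⊆ I) (hD : ∀ t ∈ Ioo α β, D < V t) (hα : V α = D) (hβ : V β = D)
    (n : ℕ) :
    FlowE I V (τ, if Even n then √(V τ - D) else -√(V τ - D)) (τ', √(V τ' - D))
      (Fm n (∫⁻ t in Ioo α τ, hh V D t) (∫⁻ t in Ioo τ τ', hh V D t) (∫⁻ t in Ioo τ' β, hh V D t)) ∧
    FlowE I V (τ, if Even n then √(V τ - D) else -√(V τ - D)) (τ', -√(V τ' - D))
      (Fm n (∫⁻ t in Ioo α τ, hh V D t) (∫⁻ t in Ioo τ τ', hh V D t) (∫⁻ t in Ioo τ' β, hh V D t)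
        + ((∫⁻ t in Ioo τ' β, hh V D t) + (∫⁻ t in Ioo τ' β, hh V D t))) := by
  have uA := FlowE.up hd (D := D) h1 ((Icc_subset_Icc_right (h2.trans h3)).trans hI)
    (fun t ht => hD t ⟨ht.1, ht.2.trans_le (h2.trans h3)⟩)
  have uK := FlowE.up hd (D := D) h2 ((Icc_subset_Icc h1 h3).trans hI)
    (fun t ht => hD t ⟨h1.trans_lt ht.1, ht.2.trans_le h3⟩)
  have uE := FlowE.up hd (D := D) h3 ((Icc_subset_Icc_left (h1.trans h2)).trans hI)
    (fun t ht => hD t ⟨(h1.trans h2).trans_lt ht.1, ht.2⟩)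
  set A := ∫⁻ t in Ioo α τ, hh V D t
  set K := ∫⁻ t in Ioo τ τ', hh V D t
  set E := ∫⁻ t in Ioo τ' β, hh V D t
  have dA := uA.rev
  have dK := uK.rev
  have dE := uE.rev
  simp only [hα, hβ, sub_self, Real.sqrt_zero, neg_zero] at uA uE dA dE
  have hτ : τ ∈ I := hI ⟨h1, h2.trans h3⟩
  have cyc : FlowE I V (τ, √(V τ - D)) (τ, √(V τ - D)) ((A + K + E) + (A + K + E)) := by
    have := uK.trans (uE.trans (dE.trans (dK.trans (dA.trans uA))))
    convert this using 1
    ring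
  have it := (cyc.iter hτ (n / 2)).trans uK
  have main : FlowE I V (τ, if Even n then √(V τ - D) else -√(V τ - D)) (τ', √(V τ' - D))
      (Fm n A K E) := by
    unfold Fm
    split_ifs with he
    · rw [zero_add]; exact it
    · have := (dA.trans uA).trans it
      rwa [← add_assoc] at this
  exact ⟨main, main.trans (uE.trans dE)⟩

lemma reach' {I : Set ℝ} {V : ℝ → ℝ} (hd : Dat I V) {α τ τ' β D L : ℝ} (hL : 0 ≤ L)
    (h1 : α ≤ τ) (h2 : τ ≤ τ')
    (h3 : τ' ≤ β) (hI : Icc α β ⊆ I) (hD : ∀ t ∈ Ioo α β, D < V t) (hα : V α = D) (hβ : V β = D)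
    (n : ℕ)
    (h : Fm n (∫⁻ t in Ioo α τ, hh V D t) (∫⁻ t in Ioo τ τ', hh V D t)
          (∫⁻ t in Ioo τ' β, hh V D t) = ENNReal.ofReal L ∨
        Fm n (∫⁻ t in Ioo α τ, hh V D t) (∫⁻ t in Ioo τ τ', hh V D t) (∫⁻ t in Ioo τ' β, hh V D t)
        + ((∫⁻ t in Ioo τ' β, hh V D t) + (∫⁻ t in Ioo τ' β, hh V D t)) = ENNReal.ofReal L) :
    ∃ v v', Flow I V (τ, v) (τ', v') L := by
  have := reach hd h1 h2 h3 hI hD hα hβ n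
  rcases h with h | h
  · rw [h] at this
    have := this.1 ENNReal.ofReal_ne_top
    rw [ENNReal.toReal_ofReal hL] at this
    exact ⟨_, _, this⟩
  · rw [h] at this
    have := this.2 ENNReal.ofReal_ne_top
    rw [ENNReal.toReal_ofReal hL] at this
    exact ⟨_, _, this⟩

end GC

namespace GC

lemma hh_mono (V : ℝ → ℝ) (τ : ℝ) : Monotone (fun D => hh V D τ) := by
  intro D D' h
  simp only [hh]
  gcongr

lemma hh_cont (V : ℝ → ℝ) (τ : ℝ) : Continuous (fun D => hh V D τ) := by
  unfold hh
  refine ENNReal.continuous_const_mul ENNReal.ofReal_ne_top |>.comp ?_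
  refine continuous_inv.comp (ENNReal.continuous_ofReal.comp ?_)
  fun_prop

lemma hh_zero (V : ℝ → ℝ) (τ : ℝ) : Tendsto (fun D => hh V D τ) atBot (𝓝 0) := by
  unfold hh
  have h1 : Tendsto (fun D => √(V τ - D)) atBot atTop := by
    refine Real.tendsto_sqrt_atTop.comp ?_
    have := tendsto_atTop_add_const_left atBot (V τ) (tendsto_neg_atBot_atTop (G := ℝ))
    exact this.congr (fun D => (sub_eq_add_neg _ _).symm)
  have h2 := ENNReal.tendsto_inv_iff.mpr (ENNReal.tendsto_ofReal_atTop.comp h1)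
  have h3 := ENNReal.Tendsto.const_mul (a := ENNReal.ofReal (V τ)) h2 (Or.inr ENNReal.ofReal_ne_top)
  simpa using h3

lemma hh_meas {I : Set ℝ} {V : ℝ → ℝ} (hd : Dat I V) {c d : ℝ} (hI : Ioo c d ⊆ I) (D : ℝ) :
    AEMeasurable (hh V D) (volume.restrict (Ioo c d)) := by
  have h : AEMeasurable V (volume.restrict (Ioo c d)) :=
    (hd.cont.mono hI).aemeasurable measurableSet_Ioo
  unfold hh
  exact h.ennreal_ofReal.mul ((h.sub_const D).sqrt.ennreal_ofReal.inv)

lemma Kfin {I : Set ℝ} {V : ℝ → ℝ} (hd : Dat I V) {c d D : ℝ} 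
    (hI : Icc c d ⊆ I) (hD : ∀ τ ∈ Icc c d, D < V τ) : ∫⁻ τ in Ioo c d, hh V D τ ≠ ∞ := by
  rcases lt_or_ge d c with hcd | hcd
  · simp [Ioo_eq_empty (not_lt.mpr hcd.le)]
  obtain ⟨z, hz, hz'⟩ := exists_min hd hcd hI
  obtain ⟨y, hy, hy'⟩ := exists_maxV hd hcd hI
  have hb : ∫⁻ τ in Ioo c d, hh V D τ ≤
      ∫⁻ τ in Ioo c d, ENNReal.ofReal (V y) * (ENNReal.ofReal (√(V z - D)))⁻¹ := by
    refine setLIntegral_mono' measurableSet_Ioo (fun τ hτ => ?_)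
    have h1 := hz' τ (Ioo_subset_Icc_self hτ)
    have h2 := hy' τ (Ioo_subset_Icc_self hτ)
    unfold hh
    gcongr
  refine ne_top_of_le_ne_top ?_ hb
  rw [setLIntegral_const]
  have : 0 < √(V z - D) := Real.sqrt_pos.mpr (by linarith [hD z hz])
  refine ENNReal.mul_ne_top (ENNReal.mul_ne_top ENNReal.ofReal_ne_top ?_) (by simp)
  simp [this]

lemma Kcont {I : Set ℝ} {V : ℝ → ℝ} (hd : Dat I V) {c d μ : ℝ} (hI : Ioo c d ⊆ I)
    (hfin : ∫⁻ τ in Ioo c d, hh V μ τ ≠ ∞) :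
    ContinuousOn (fun D => ∫⁻ τ in Ioo c d, hh V D τ) (Iic μ) := by
  intro D0 hD0
  refine tendsto_lintegral_filter_of_dominated_convergence' (hh V μ) ?_ ?_ hfin ?_
  · exact Eventually.of_forall fun D => hh_meas hd hI D
  · filter_upwards [self_mem_nhdsWithin] with D hD
    exact ae_of_all _ fun τ => hh_mono V τ hD
  · exact ae_of_all _ fun τ => (hh_cont V τ).continuousWithinAt

lemma KcontAt {I : Set ℝ} {V : ℝ → ℝ} (hd : Dat I V) {c d D : ℝ} 
    (hI : Icc c d ⊆ I) (hD : ∀ τ ∈ Icc c d, D < V τ) :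
    ContinuousAt (fun D => ∫⁻ τ in Ioo c d, hh V D τ) D := by
  rcases lt_or_ge d c with hcd | hcd
  · simp only [Ioo_eq_empty (not_lt.mpr hcd.le)]; simp [continuousAt_const]
  obtain ⟨z, hz, hz'⟩ := exists_min hd hcd hI
  obtain ⟨μ, h1, h2⟩ := exists_between (hD z hz)
  exact (Kcont hd (μ := μ) (Ioo_subset_Icc_self.trans hI) (Kfin hd hI
    (fun τ hτ => h2.trans_le (hz' τ hτ)))).continuousAt (Iic_mem_nhds h1)

lemma Kzero {I : Set ℝ} {V : ℝ → ℝ} (hd : Dat I V) {c d μ : ℝ} (hI : Ioo c d ⊆ I)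
    (hfin : ∫⁻ τ in Ioo c d, hh V μ τ ≠ ∞) :
    Tendsto (fun D => ∫⁻ τ in Ioo c d, hh V D τ) atBot (𝓝 0) := by
  have := tendsto_lintegral_filter_of_dominated_convergence' (l := atBot)
    (μ := volume.restrict (Ioo c d)) (F := fun D τ => hh V D τ) (f := fun _ => 0) (hh V μ)
    (Eventually.of_forall fun D => hh_meas hd hI D) (by
      filter_upwards [eventually_le_atBot μ] with D hD
      exact ae_of_all _ fun τ => hh_mono V τ hD) hfin
    (ae_of_all _ fun τ => hh_zero V τ)
  simpa using this

lemma Klsc {I : Set ℝ} {V : ℝ → ℝ} (hd : Dat I V) {c d μ : ℝ} (hI : Ioo c d ⊆ I) {y : ℝ≥0∞}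
    (hy : y < ∫⁻ τ in Ioo c d, hh V μ τ) : ∃ D < μ, y < ∫⁻ τ in Ioo c d, hh V D τ := by
  have hlim : Tendsto (fun n : ℕ => μ - 1 / ((n : ℝ) + 1)) atTop (𝓝 μ) := by
    simpa using tendsto_const_nhds.sub (tendsto_one_div_add_atTop_nhds_zero_nat (𝕜 := ℝ))
  have := lintegral_tendsto_of_tendsto_of_monotone (μ := volume.restrict (Ioo c d))
    (f := fun (n : ℕ) τ => hh V (μ - 1 / ((n : ℝ) + 1)) τ) (F := hh V μ)
    (fun n => hh_meas hd hI _)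
    (ae_of_all _ fun τ => by
      intro m n hmn
      apply hh_mono
      have := Nat.one_div_le_one_div (α := ℝ) hmn
      linarith)
    (ae_of_all _ fun τ => ((hh_cont V τ).tendsto μ).comp hlim)
  obtain ⟨n, hn⟩ := (this.eventually (lt_mem_nhds hy)).exists
  exact ⟨_, by have : 0 < 1 / ((n : ℝ) + 1) := by positivity
               linarith, hn⟩

lemma direct {I : Set ℝ} {V : ℝ → ℝ} (hd : Dat I V) {c d μ L : ℝ} (hcd : c < d)
    (hI : Icc c d ⊆ I) (hμ : ∀ τ ∈ Icc c d, μ ≤ V τ) (hL : 0 < L)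
    (h : ENNReal.ofReal L < ∫⁻ τ in Ioo c d, hh V μ τ) : ∃ v v', Flow I V (c, v) (d, v') L := by
  have hI' := Ioo_subset_Icc_self.trans hI
  obtain ⟨D1, h1, h2⟩ := Klsc hd hI' h
  have hfin := Kfin hd (D := D1) hI (fun τ hτ => h1.trans_le (hμ τ hτ))
  obtain ⟨D2, h3, h4⟩ := ((Kzero hd hI' hfin).eventually
    (gt_mem_nhds (ENNReal.ofReal_pos.mpr hL))).and (eventually_le_atBot D1) |>.exists
  obtain ⟨D, hD, hDL⟩ := intermediate_value_Icc h4 ((Kcont hd hI' hfin).mono Icc_subset_Iic_self)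
    ⟨h3.le, h2.le⟩
  have := FlowE.up hd (D := D) hcd.le hI
    (fun τ hτ => (hD.2.trans_lt h1).trans_le (hμ τ (Ioo_subset_Icc_self hτ)))
  simp only at hDL
  rw [hDL] at this
  have := this ENNReal.ofReal_ne_top
  rw [ENNReal.toReal_ofReal hL.le] at this
  exact ⟨_, _, this⟩

lemma taylor {I : Set ℝ} {V : ℝ → ℝ} (hd : Dat I V) {c d z : ℝ} (hI : Icc c d ⊆ I)
    (hz : z ∈ Icc c d) (h0 : deriv V z = 0) :
    ∃ M : ℝ, 0 < M ∧ ∀ τ ∈ Icc c d, V τ - V z ≤ M ^ 2 * (τ - z) ^ 2 := by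
  have h1 : ContDiffOn ℝ 1 (deriv V) I :=
    ((contDiffOn_succ_iff_deriv_of_isOpen (n := 1) hd.opn).mp hd.smooth).2.2
  have h2 : ContinuousOn (deriv (deriv V)) I := h1.continuousOn_deriv_of_isOpen hd.opn le_rfl
  obtain ⟨M, hM⟩ := isCompact_Icc.exists_bound_of_continuousOn (h2.mono hI)
  have hM0 : 0 ≤ M := (norm_nonneg _).trans (hM z hz)
  have h3 : ∀ τ ∈ Icc c d, ‖deriv V τ‖ ≤ M * ‖τ - z‖ := by
    intro τ hτ
    have := (convex_Icc c d).norm_image_sub_le_of_norm_deriv_le (f := deriv V) (C := M)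
      (fun x hx => (h1.differentiableOn (by norm_num) x (hI hx)).differentiableAt
        (hd.opn.mem_nhds (hI hx))) hM hz hτ
    rwa [h0, sub_zero] at this
  refine ⟨M + 1, by linarith, fun τ hτ => ?_⟩
  have hsub : uIcc z τ ⊆ Icc c d := uIcc_subset_Icc hz hτ
  have := (convex_uIcc z τ).norm_image_sub_le_of_norm_deriv_le (f := V) (C := M * ‖τ - z‖)
      (fun x hx => (hd.hasDeriv (hI (hsub hx))).differentiableAt) (fun x hx => by
        refine (h3 x (hsub hx)).trans ?_
        gcongr 
        have := abs_sub_left_of_mem_uIcc hx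
        simpa [abs_sub_comm] using this) left_mem_uIcc right_mem_uIcc
  have h5 := (le_abs_self _).trans this
  have h6 : M * ‖τ - z‖ * ‖τ - z‖ = M * (τ - z) ^ 2 := by
    rw [mul_assoc, Real.norm_eq_abs, abs_mul_abs_self]; ring
  rw [h6] at h5
  refine h5.trans ?_
  gcongr
  nlinarith

lemma diverge {I : Set ℝ} {V : ℝ → ℝ} (hd : Dat I V) {c d z D : ℝ} (hcd : c < d) (hI : Icc c d ⊆ I)
    (hz : z ∈ Icc c d) (h0 : deriv V z = 0) (hD : V z ≤ D) :
    ∫⁻ τ in Ioo c d, hh V D τ = ∞ := by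
  obtain ⟨M, hM, hT⟩ := taylor hd hI hz h0
  obtain ⟨y, hy, hy'⟩ := exists_min hd hcd.le hI
  have hyp := hd.pos y (hI hy)
  by_contra hfin
  have hle : ∫⁻ τ in Ioo c d, ‖(V y / M) * (τ - z)⁻¹‖ₑ ≤ ∫⁻ τ in Ioo c d, hh V D τ := by
    refine setLIntegral_mono' measurableSet_Ioo (fun τ hτ => ?_)
    have hτ' := Ioo_subset_Icc_self hτ
    have h1 : √(V τ - D) ≤ M * |τ - z| := by
      rw [Real.sqrt_le_left (by positivity), mul_pow, sq_abs]
      linarith [hT τ hτ']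
    rcases eq_or_ne τ z with h | h
    · subst h; simp
    have hp : 0 < |τ - z| := abs_pos.mpr (sub_ne_zero.mpr h)
    have h2 : ‖(V y / M) * (τ - z)⁻¹‖ₑ = ENNReal.ofReal (V y) * (ENNReal.ofReal (M * |τ - z|))⁻¹ := by
      rw [← ENNReal.ofReal_inv_of_pos (by positivity), ← ENNReal.ofReal_mul hyp.le,
        Real.enorm_eq_ofReal_abs]
      congr 1
      rw [abs_mul, abs_inv, abs_of_pos (by positivity : 0 < V y / M)]
      field_simp
    rw [h2]
    unfold hh
    gcongr
    exact hy' τ hτ'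
  have hint : IntegrableOn (fun τ => (V y / M) * (τ - z)⁻¹) (Ioo c d) :=
    ⟨by fun_prop, hle.trans_lt (lt_top_iff_ne_top.mpr hfin)⟩
  have h3 : IntervalIntegrable (fun τ => (τ - z)⁻¹) volume c d := by
    rw [intervalIntegrable_iff_integrableOn_Ioo_of_le hcd.le]
    have this : IntegrableOn (fun τ => (V y / M)⁻¹ * ((V y / M) * (τ - z)⁻¹)) (Ioo c d) :=
      hint.const_mul (V y / M)⁻¹
    refine this.congr_fun (fun τ _ => ?_) measurableSet_Ioo
    have : V y / M ≠ 0 := by positivity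
    simp only []
    rw [← mul_assoc, inv_mul_cancel₀ this, one_mul]
  rw [intervalIntegrable_sub_inv_iff] at h3
  rcases h3 with h3 | h3
  · exact hcd.ne h3
  · exact h3 (by rwa [uIcc_of_le hcd.le])

lemma ftc {I : Set ℝ} {V : ℝ → ℝ} (hd : Dat I V) {s β κ C D : ℝ} (hsb : s < β) (hI : Icc s β ⊆ I)
    (hκ : 0 < κ) (hV' : ∀ τ ∈ Icc s β, deriv V τ ≤ -κ) (hC : ∀ τ ∈ Icc s β, V τ ≤ C)
    (hD : D ≤ V β) :
    ∫⁻ τ in Ioo s β, hh V D τ ≤ ENNReal.ofReal (2 * C / κ * √(V s - D)) := by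
  have hβI : β ∈ Icc s β := ⟨hsb.le, le_rfl⟩
  have hC0 : 0 < C := (hd.pos β (hI hβI)).trans_le (hC β hβI)
  have hanti : StrictAntiOn V (Icc s β) := by
    refine strictAntiOn_of_deriv_neg (convex_Icc s β) (hd.cont.mono hI) (fun τ hτ => ?_)
    rw [interior_Icc] at hτ
    linarith [hV' τ (Ioo_subset_Icc_self hτ)]
  have hgt : ∀ τ ∈ Ioo s β, D < V τ := fun τ hτ =>
    hD.trans_lt (hanti (Ioo_subset_Icc_self hτ) hβI hτ.2)
  set g : ℝ → ℝ := fun τ => -(2 * C / κ) * √(V τ - D) with hg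
  set g' : ℝ → ℝ := fun τ => -(2 * C / κ) * (deriv V τ / (2 * √(V τ - D))) with hg'
  have hgc : ContinuousOn g (Icc s β) :=
    continuousOn_const.mul ((hd.cont.mono hI).sub continuousOn_const).sqrt
  have hgd : ∀ τ ∈ Ioo s β, HasDerivAt g (g' τ) τ := by
    intro τ hτ
    have hp : V τ - D ≠ 0 := by linarith [hgt τ hτ]
    exact (((hd.hasDeriv (hI (Ioo_subset_Icc_self hτ))).sub_const D).sqrt hp).const_mul _
  have hge : ∀ τ ∈ Ioo s β, V τ * (√(V τ - D))⁻¹ ≤ g' τ := by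
    intro τ hτ
    have hp : 0 < √(V τ - D) := Real.sqrt_pos.mpr (by linarith [hgt τ hτ])
    have h1 := hV' τ (Ioo_subset_Icc_self hτ)
    have h2 := hC τ (Ioo_subset_Icc_self hτ)
    have h3 : g' τ = (C / κ * (-deriv V τ)) * (√(V τ - D))⁻¹ := by
      simp only [hg']; field_simp
    rw [h3]
    gcongr
    have : C = C / κ * κ := by field_simp
    calc V τ ≤ C / κ * κ := by rw [← this]; exact h2
      _ ≤ C / κ * (-deriv V τ) := by gcongr; linarith
  have hVpos : ∀ τ ∈ Ioo s β, 0 < V τ := fun τ hτ => hd.pos τ (hI (Ioo_subset_Icc_self hτ))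
  have hg0 : ∀ τ ∈ Ioo s β, 0 ≤ g' τ := fun τ hτ =>
    (mul_nonneg (hVpos τ hτ).le (by positivity)).trans (hge τ hτ)
  have hint := intervalIntegral.integrableOn_deriv_of_nonneg hgc hgd hg0
  have hval := intervalIntegral.integral_eq_sub_of_hasDerivAt_of_le hsb.le hgc hgd
    ((intervalIntegrable_iff_integrableOn_Ioc_of_le hsb.le).mpr hint)
  rw [intervalIntegral.integral_of_le hsb.le, integral_Ioc_eq_integral_Ioo] at hval
  calc ∫⁻ τ in Ioo s β, hh V D τ ≤ ∫⁻ τ in Ioo s β, ENNReal.ofReal (g' τ) := by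
        refine setLIntegral_mono' measurableSet_Ioo (fun τ hτ => ?_)
        rw [hh_eq (hVpos τ hτ).le (hgt τ hτ)]
        exact ENNReal.ofReal_le_ofReal (hge τ hτ)
    _ = ENNReal.ofReal (∫ τ in Ioo s β, g' τ) := by
        rw [ofReal_integral_eq_lintegral_ofReal (hint.mono_set Ioo_subset_Ioc_self)]
        exact (ae_restrict_iff' measurableSet_Ioo).mpr (ae_of_all _ hg0)
    _ ≤ _ := by
        apply ENNReal.ofReal_le_ofReal
        rw [hval]
        simp only [hg]
        have : 0 ≤ 2 * C / κ * √(V β - D) := by positivity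
        linarith

end GC

namespace GC

lemma lsplit {a b c : ℝ} (h1 : a ≤ b) (h2 : b ≤ c) (g : ℝ → ℝ≥0∞) :
    ∫⁻ τ in Ioo a c, g τ = (∫⁻ τ in Ioo a b, g τ) + ∫⁻ τ in Ioo b c, g τ := by
  simp only [setLIntegral_congr Ioo_ae_eq_Ioc]
  rw [← Ioc_union_Ioc_eq_Ioc h1 h2, lintegral_union measurableSet_Ioc]
  exact Ioc_disjoint_Ioc_of_le le_rfl

lemma lneg (a b : ℝ) (g : ℝ → ℝ≥0∞) :
    ∫⁻ τ in Ioo (-b) (-a), g (-τ) = ∫⁻ τ in Ioo a b, g τ := by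
  have := (Measure.measurePreserving_neg (volume : Measure ℝ)).setLIntegral_comp_preimage_emb
    (MeasurableEquiv.neg ℝ).measurableEmbedding g (Ioo a b)
  simpa using this

lemma Dat.neg {I : Set ℝ} {V : ℝ → ℝ} (hd : Dat I V) : Dat (Neg.neg ⁻¹' I) (fun t => V (-t)) where
  opn := hd.opn.preimage continuous_neg
  ord := hd.ord.preimage_anti (fun a b h => neg_le_neg h)
  smooth := hd.smooth.comp contDiff_neg.contDiffOn (fun x hx => hx)
  pos := fun τ hτ => hd.pos _ hτ

structure IsB (I : Set ℝ) (V : ℝ → ℝ) (c D β : ℝ) : Prop where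
  mem : β ∈ I
  lt : c < β
  eq : V β = D
  gt : ∀ τ ∈ Ico c β, D < V τ

lemma IsB.sub {I : Set ℝ} {V : ℝ → ℝ} (hd : Dat I V) {c D β : ℝ} (hc : c ∈ I) (h : IsB I V c D β) :
    Icc c β ⊆ I := hd.ord.out hc h.mem

lemma existsB {I : Set ℝ} {V : ℝ → ℝ} (hd : Dat I V) {c D : ℝ} (hc : c ∈ I)
    (hD : D < V c) (h2 : ∃ τ ∈ I, c < τ ∧ V τ < D) : ∃ β, IsB I V c D β := by
  obtain ⟨τ1, hτ1, hcτ, hV1⟩ := h2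
  have hI : Icc c τ1 ⊆ I := hd.ord.out hc hτ1
  have hcl : IsCompact (Icc c τ1 ∩ V ⁻¹' Iic D) :=
    isCompact_Icc.of_isClosed_subset
      ((hd.cont.mono hI).preimage_isClosed_of_isClosed isClosed_Icc isClosed_Iic) inter_subset_left
  obtain ⟨β, hβ, hmin⟩ := hcl.exists_isLeast ⟨τ1, ⟨hcτ.le, le_rfl⟩, hV1.le⟩
  have hcβ : c < β := by
    rcases hβ.1.1.lt_or_eq with h | h
    · exact h
    · subst h; exact absurd hβ.2 (not_le.mpr hD)
  have hgt : ∀ τ ∈ Ico c β, D < V τ := by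
    intro τ hτ
    by_contra hh
    exact absurd (hmin ⟨⟨hτ.1, hτ.2.le.trans hβ.1.2⟩, not_lt.mp hh⟩) (not_le.mpr hτ.2)
  refine ⟨β, hI hβ.1, hcβ, ?_, hgt⟩
  obtain ⟨t, ht, htD⟩ := intermediate_value_Icc' hcβ.le
    ((hd.cont.mono ((Icc_subset_Icc_right hβ.1.2).trans hI))) ⟨hβ.2, hD.le⟩
  have : β ≤ t := hmin ⟨⟨ht.1, ht.2.trans hβ.1.2⟩, htD.le⟩
  rw [le_antisymm this ht.2]; exact htD

lemma deriv_le {I : Set ℝ} {V : ℝ → ℝ} (hd : Dat I V) {c β : ℝ} (hβ : β ∈ I) (hc : c < β)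
    (h : ∀ τ ∈ Ioo c β, V β ≤ V τ) : deriv V β ≤ 0 := by
  have h1 := (hasDerivAt_iff_tendsto_slope.mp (hd.hasDeriv hβ)).mono_left
    (nhdsWithin_mono β (fun x (hx : x ∈ Iio β) => ne_of_lt hx))
  refine le_of_tendsto h1 ?_
  filter_upwards [Ioo_mem_nhdsLT hc] with τ hτ
  rw [slope_def_field]
  exact div_nonpos_of_nonneg_of_nonpos (by linarith [h τ hτ]) (by linarith [hτ.2])

lemma nbhd {I : Set ℝ} {V : ℝ → ℝ} (hd : Dat I V) {β : ℝ} (hβ : β ∈ I) (h : deriv V β < 0) :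
    ∃ δ κ C : ℝ, 0 < δ ∧ 0 < κ ∧ ∀ τ ∈ Icc (β - δ) (β + δ), τ ∈ I ∧ deriv V τ ≤ -κ ∧ V τ ≤ C := by
  have h1 : ∀ᶠ τ in 𝓝 β, τ ∈ I := hd.opn.mem_nhds hβ
  have h2 : ∀ᶠ τ in 𝓝 β, deriv V τ < deriv V β / 2 :=
    (hd.contDeriv.continuousAt h1).eventually (gt_mem_nhds (by linarith))
  have h3 : ∀ᶠ τ in 𝓝 β, V τ < V β + 1 :=
    (hd.cont.continuousAt h1).eventually (gt_mem_nhds (by linarith))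
  obtain ⟨δ, hδ, hb⟩ := Metric.nhds_basis_closedBall.eventually_iff.mp (h1.and (h2.and h3))
  rw [Real.closedBall_eq_Icc] at hb
  refine ⟨δ, -(deriv V β / 2), V β + 1, hδ, by linarith, fun τ hτ => ?_⟩
  obtain ⟨p, q, r⟩ := hb hτ
  exact ⟨p, by linarith, r.le⟩

lemma anti_of {I : Set ℝ} {V : ℝ → ℝ} (hd : Dat I V) {a b κ : ℝ} (hκ : 0 < κ)
    (h : ∀ τ ∈ Icc a b, τ ∈ I ∧ deriv V τ ≤ -κ) : StrictAntiOn V (Icc a b) := by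
  refine strictAntiOn_of_deriv_neg (convex_Icc a b) (hd.cont.mono fun τ hτ => (h τ hτ).1)
    (fun τ hτ => ?_)
  rw [interior_Icc] at hτ
  linarith [(h τ (Ioo_subset_Icc_self hτ)).2]

lemma B_gt {I : Set ℝ} {V : ℝ → ℝ} (hd : Dat I V) {c s D0 m M : ℝ} {b : ℝ → ℝ}
    (hb : ∀ D ∈ Ioo m M, IsB I V c D (b D)) (hD0 : D0 ∈ Ioo m M) (hcs : c ≤ s)
    (hI : Icc c s ⊆ I) (hs : ∀ τ ∈ Icc c s, D0 < V τ) : ∀ᶠ D in 𝓝 D0, s < b D := by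
  obtain ⟨z, hz, hz'⟩ := exists_min hd hcs hI
  filter_upwards [Ioo_mem_nhds hD0.1 hD0.2, gt_mem_nhds (hs z hz)] with D hD hDz
  by_contra hle
  have h1 := hb D hD
  have := hz' (b D) ⟨h1.lt.le, not_lt.mp hle⟩
  rw [h1.eq] at this
  linarith

lemma Bcont {I : Set ℝ} {V : ℝ → ℝ} (hd : Dat I V) {c m M D0 : ℝ} (hc : c ∈ I) {b : ℝ → ℝ}
    (hb : ∀ D ∈ Ioo m M, IsB I V c D (b D)) (hD0 : D0 ∈ Ioo m M) :
    ContinuousAt (fun D => ∫⁻ τ in Ioo c (b D), hh V D τ) D0 := by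
  have hb0 := hb D0 hD0
  set β := b D0 with hβ
  have hsub := hb0.sub hd hc
  have hsubs : ∀ s < β, Icc c s ⊆ I := fun s hs => (Icc_subset_Icc_right hs.le).trans hsub
  have hgts : ∀ s < β, ∀ τ ∈ Icc c s, D0 < V τ := fun s hs τ hτ =>
    hb0.gt τ ⟨hτ.1, hτ.2.trans_lt hs⟩
  refine tendsto_order.2 ⟨fun y hy => ?_, fun y hy => ?_⟩
  · have hex : ∃ s, c < s ∧ s < β ∧ y < ∫⁻ τ in Ioo c s, hh V D0 τ := by
      have hlim : Tendsto (fun n : ℕ => β - 1 / ((n : ℝ) + 1)) atTop (𝓝 β) := by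
        simpa using tendsto_const_nhds.sub (tendsto_one_div_add_atTop_nhds_zero_nat (𝕜 := ℝ))
      have hmono : Monotone (fun n : ℕ => Ioo c (β - 1 / ((n : ℝ) + 1))) := by
        intro i j hij
        apply Ioo_subset_Ioo_right
        have := Nat.one_div_le_one_div (α := ℝ) hij
        linarith
      have hun : (⋃ n : ℕ, Ioo c (β - 1 / ((n : ℝ) + 1))) = Ioo c β := by
        ext τ
        simp only [mem_iUnion, mem_Ioo]
        constructor
        · rintro ⟨n, h1, h2⟩
          have : 0 < 1 / ((n : ℝ) + 1) := by positivity
          exact ⟨h1, by linarith⟩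
        · rintro ⟨h1, h2⟩
          obtain ⟨n, hn⟩ := (hlim.eventually (lt_mem_nhds h2)).exists
          exact ⟨n, h1, hn⟩
      have hy' : y < ∫⁻ τ in Ioo c β, hh V D0 τ := hy
      rw [← hun, setLIntegral_iUnion_of_directed _ hmono.directed_le, lt_iSup_iff] at hy'
      obtain ⟨n, hn⟩ := hy'
      have hp : 0 < 1 / ((n : ℝ) + 1) := by positivity
      refine ⟨_, ?_, by linarith, hn⟩
      by_contra hle
      rw [Ioo_eq_empty hle] at hn
      simp at hn
    obtain ⟨s, hcs, hsβ, hys⟩ := hex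
    filter_upwards [B_gt hd hb hD0 hcs.le (hsubs s hsβ) (hgts s hsβ),
      (KcontAt hd (hsubs s hsβ) (hgts s hsβ)).eventually (lt_mem_nhds hys)] with D h1 h2
    exact h2.trans_le (lintegral_mono_set (Ioo_subset_Ioo_right h1.le))
  · have hy' : ∫⁻ τ in Ioo c β, hh V D0 τ < y := hy
    have hne : deriv V β ≠ 0 := by
      intro h0
      have := diverge hd hb0.lt hsub ⟨hb0.lt.le, le_rfl⟩ h0 hb0.eq.le
      rw [this] at hy'
      exact not_top_lt hy'
    have hneg : deriv V β < 0 := lt_of_le_of_ne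
      (deriv_le hd hb0.mem hb0.lt (fun τ hτ => by
        rw [hb0.eq]; exact (hb0.gt τ (Ioo_subset_Ico_self hτ)).le)) hne
    obtain ⟨δ, κ, C, hδ, hκ, hN⟩ := nbhd hd hb0.mem hneg
    have hanti := anti_of hd hκ (fun τ hτ => ⟨(hN τ hτ).1, (hN τ hτ).2.1⟩)
    have hlim : Tendsto (fun s => (∫⁻ τ in Ioo c β, hh V D0 τ) +
        ENNReal.ofReal (2 * C / κ * √(V s - D0))) (𝓝[<] β)
        (𝓝 ((∫⁻ τ in Ioo c β, hh V D0 τ) + ENNReal.ofReal (2 * C / κ * √(V β - D0)))) := by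
      have hVc : Tendsto V (𝓝[<] β) (𝓝 (V β)) :=
        (hd.hasDeriv hb0.mem).continuousAt.tendsto.mono_left nhdsWithin_le_nhds
      refine tendsto_const_nhds.add (ENNReal.tendsto_ofReal ?_)
      exact ((hVc.sub_const D0).sqrt).const_mul _
    rw [hb0.eq] at hlim
    simp only [sub_self, Real.sqrt_zero, mul_zero, ENNReal.ofReal_zero, add_zero] at hlim
    have e1 : ∀ᶠ s in 𝓝[<] β, s ∈ Ioo c β := Ioo_mem_nhdsLT hb0.lt
    have e2 : ∀ᶠ s in 𝓝[<] β, s ∈ Ioo (β - δ) β := Ioo_mem_nhdsLT (by linarith)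
    obtain ⟨s, hs1, hs2, hs3⟩ := ((hlim.eventually (gt_mem_nhds hy')).and (e1.and e2)).exists
    have hΦ : ContinuousAt (fun D => (∫⁻ τ in Ioo c s, hh V D τ) +
        ENNReal.ofReal (2 * C / κ * √(V s - D))) D0 := by
      refine (KcontAt hd (hsubs s hs2.2) (hgts s hs2.2)).add ?_
      refine ENNReal.continuous_ofReal.continuousAt.comp ?_
      fun_prop
    have hΦ0 : (∫⁻ τ in Ioo c s, hh V D0 τ) + ENNReal.ofReal (2 * C / κ * √(V s - D0)) < y :=
      lt_of_le_of_lt (add_le_add (lintegral_mono_set (Ioo_subset_Ioo_right hs2.2.le)) le_rfl) hs1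
    have hVe : V (β + δ) < D0 := by
      rw [← hb0.eq]
      exact hanti ⟨by linarith, by linarith⟩ ⟨by linarith, by linarith⟩ (by linarith)
    filter_upwards [B_gt hd hb hD0 hs2.1.le (hsubs s hs2.2) (hgts s hs2.2),
      hΦ.eventually (gt_mem_nhds hΦ0), lt_mem_nhds hVe, Ioo_mem_nhds hD0.1 hD0.2]
      with D h1 h2 h3 h4
    have hbD := hb D h4
    have h5 : b D < β + δ := by
      by_contra hle
      rcases (not_lt.mp hle).lt_or_eq with h | h
      · have := hbD.gt (β + δ) ⟨by linarith [hb0.lt], h⟩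
        linarith
      · rw [h, hbD.eq] at h3
        exact lt_irrefl _ h3
    have hsubN : Icc s (b D) ⊆ Icc (β - δ) (β + δ) := Icc_subset_Icc hs3.1.le h5.le
    refine lt_of_le_of_lt ?_ h2
    rw [lsplit hs2.1.le h1.le]
    refine add_le_add le_rfl ?_
    exact ftc hd h1 (fun τ hτ => (hN τ (hsubN hτ)).1) hκ (fun τ hτ => (hN τ (hsubN hτ)).2.1)
      (fun τ hτ => (hN τ (hsubN hτ)).2.2) hbD.eq.ge

end GC

namespace GC

def Kf (V : ℝ → ℝ) (a b D : ℝ) : ℝ≥0∞ := ∫⁻ τ in Ioo a b, hh V D τ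

structure Osc (I : Set ℝ) (V : ℝ → ℝ) (τ0 τ1 D α β : ℝ) : Prop where
  ma : α ∈ I
  mb : β ∈ I
  la : α ≤ τ0
  lb : τ1 ≤ β
  ea : V α = D
  eb : V β = D
  gt : ∀ t ∈ Ioo α β, D < V t

lemma choose_c {I : Set ℝ} {V : ℝ → ℝ} (hd : Dat I V) {τ0 τ1 : ℝ} (h0 : τ0 ∈ I) (h1 : τ1 ∈ I)
    (hμ : ∀ τ ∈ Icc τ0 τ1, V τ1 ≤ V τ)
    (hcase : τ0 < τ1 ∨ (τ0 = τ1 ∧ deriv V τ1 < 0)) (hK : Kf V τ0 τ1 (V τ1) ≠ ∞) :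
    ∃ c ∈ I, c < τ1 ∧ V τ1 < V c ∧ (∀ τ ∈ Ioo (min τ0 c) τ1, V τ1 < V τ) ∧
      Kf V (min τ0 c) τ1 (V τ1) ≠ ∞ := by
  rcases hcase with h | ⟨rfl, h⟩
  · have hI : Icc τ0 τ1 ⊆ I := hd.ord.out h0 h1
    have hgt : ∀ τ ∈ Ioo τ0 τ1, V τ1 < V τ := by
      intro τ hτ
      refine lt_of_le_of_ne (hμ τ (Ioo_subset_Icc_self hτ)) (fun he => ?_)
      apply hK
      have hmin : IsLocalMin V τ := by
        filter_upwards [Ioo_mem_nhds hτ.1 hτ.2] with t ht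
        rw [← he]; exact hμ t (Ioo_subset_Icc_self ht)
      exact diverge hd h hI (Ioo_subset_Icc_self hτ) hmin.deriv_eq_zero he.ge
    have hc : (τ0 + τ1) / 2 ∈ Ioo τ0 τ1 := ⟨by linarith, by linarith⟩
    have hmin : min τ0 ((τ0 + τ1) / 2) = τ0 := min_eq_left hc.1.le
    refine ⟨(τ0 + τ1) / 2, hI (Ioo_subset_Icc_self hc), hc.2, hgt _ hc, ?_, ?_⟩ <;> rw [hmin]
    · exact hgt
    · exact hK
  · obtain ⟨δ, κ, C, hδ, hκ, hN⟩ := nbhd hd h1 h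
    have hanti := anti_of hd hκ (fun τ hτ => ⟨(hN τ hτ).1, (hN τ hτ).2.1⟩)
    have hmin : min τ0 (τ0 - δ) = τ0 - δ := min_eq_right (by linarith)
    have hsub : Icc (τ0 - δ) τ0 ⊆ Icc (τ0 - δ) (τ0 + δ) := Icc_subset_Icc_right (by linarith)
    have hlt : ∀ τ ∈ Ico (τ0 - δ) τ0, V τ0 < V τ := fun τ hτ =>
      hanti (hsub ⟨hτ.1, hτ.2.le⟩) (hsub ⟨by linarith, le_rfl⟩) hτ.2
    refine ⟨τ0 - δ, (hN _ ⟨le_rfl, by linarith⟩).1, by linarith, hlt _ ⟨le_rfl, by linarith⟩, ?_, ?_⟩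
      <;> rw [hmin]
    · exact fun τ hτ => hlt τ (Ioo_subset_Ico_self hτ)
    · exact ne_top_of_le_ne_top ENNReal.ofReal_ne_top
        (ftc hd (by linarith) (fun τ hτ => (hN τ (hsub hτ)).1) hκ (fun τ hτ => (hN τ (hsub hτ)).2.1)
          (fun τ hτ => (hN τ (hsub hτ)).2.2) le_rfl)

lemma Fm_cont (n : ℕ) {A K E : ℝ → ℝ≥0∞} {S : Set ℝ} (hA : ContinuousOn A S) (hK : ContinuousOn K S)
    (hE : ContinuousOn E S) : ContinuousOn (fun D => Fm n (A D) (K D) (E D)) S := by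
  unfold Fm
  refine (ContinuousOn.add ?_ ?_).add hK
  · split_ifs
    · exact continuousOn_const
    · exact hA.add hA
  · exact (continuous_nsmul (n / 2)).comp_continuousOn
      (((hA.add hK).add hE).add ((hA.add hK).add hE))

lemma core {I : Set ℝ} {V : ℝ → ℝ} (hd : Dat I V) {m τ0 τ1 L : ℝ}
    (hm : ∀ τ ∈ I, m < V τ)
    (h2 : ∀ D > m, ∀ s ∈ I, ∃ τ ∈ I, s < τ ∧ V τ < D)
    (h3 : ∀ D > m, ∀ s ∈ I, ∃ τ ∈ I, τ < s ∧ V τ < D)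
    (h0 : τ0 ∈ I) (h1 : τ1 ∈ I) (h01 : τ0 ≤ τ1)
    (hμ : ∀ τ ∈ Icc τ0 τ1, V τ1 ≤ V τ)
    (hcase : τ0 < τ1 ∨ (τ0 = τ1 ∧ deriv V τ1 < 0)) (hL : 0 < L) :
    (∃ v v', Flow I V (τ0, v) (τ1, v') L) ∨
    ∃ α β : ℝ → ℝ, (∀ D ∈ Ioc m (V τ1), Osc I V τ0 τ1 D (α D) (β D)) ∧
      (∀ D ∈ Ioc m (V τ1), Kf V τ0 τ1 D + (Kf V τ1 (β D) D + Kf V τ1 (β D) D) ≤ ENNReal.ofReal L) ∧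
      ∀ n : ℕ, ∀ D1 ∈ Ioc m (V τ1), ∀ D2 ∈ Ioc m (V τ1),
        Fm n (Kf V (α D1) τ0 D1) (Kf V τ0 τ1 D1) (Kf V τ1 (β D1) D1) ≤ ENNReal.ofReal L →
        ENNReal.ofReal L ≤ Fm n (Kf V (α D2) τ0 D2) (Kf V τ0 τ1 D2) (Kf V τ1 (β D2) D2) +
          (Kf V τ1 (β D2) D2 + Kf V τ1 (β D2) D2) → ∃ v v', Flow I V (τ0, v) (τ1, v') L := by
  set μ := V τ1 with hμdef
  have hI01 : Icc τ0 τ1 ⊆ I := hd.ord.out h0 h1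
  by_cases hKL : ENNReal.ofReal L < Kf V τ0 τ1 μ
  · left
    rcases hcase with h | ⟨rfl, _⟩
    · exact direct hd h hI01 hμ hL hKL
    · simp [Kf] at hKL
  rw [not_lt] at hKL
  have hKfin : Kf V τ0 τ1 μ ≠ ∞ := ne_top_of_le_ne_top ENNReal.ofReal_ne_top hKL
  obtain ⟨c, hcI, hc1, hVc, hgt, hfin⟩ := choose_c hd h0 h1 hμ hcase hKfin
  have hIoo : ∀ {a b}, a ∈ I → b ∈ I → Ioo a b ⊆ I := fun ha hb =>
    Ioo_subset_Icc_self.trans (hd.ord.out ha hb)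
  have hex : ∀ D, D ∈ Ioo m (V c) → ∃ β, IsB I V c D β := fun D hD =>
    existsB hd hcI hD.2 (h2 D hD.1 c hcI)
  choose! b hb using hex
  have hex' : ∀ D, D ∈ Ioo m (V c) → ∃ β, IsB (Neg.neg ⁻¹' I) (fun t => V (-t)) (-c) D β := by
    intro D hD
    refine existsB hd.neg (by simpa using hcI) (by simpa using hD.2) ?_
    obtain ⟨τ, p, q, r⟩ := h3 D hD.1 c hcI
    exact ⟨-τ, by simpa using p, by linarith, by simpa using r⟩
  choose! a ha using hex'
  have hsubD : Ioc m μ ⊆ Ioo m (V c) := fun D hD => ⟨hD.1, hD.2.trans_lt hVc⟩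
  have hmμ : m < μ := hm τ1 h1
  have hμmem : μ ∈ Ioc m μ := ⟨hmμ, le_rfl⟩
  have hlb : ∀ D ∈ Ioc m μ, τ1 ≤ b D := by
    intro D hD
    by_contra hlt
    have hB := hb D (hsubD hD)
    have := hgt (b D) ⟨(min_le_right _ _).trans_lt hB.lt, not_le.mp hlt⟩
    rw [hB.eq] at this
    linarith [hD.2]
  have hac : ∀ D ∈ Ioc m μ, -a D < c := fun D hD => by linarith [(ha D (hsubD hD)).lt]
  have hla : ∀ D ∈ Ioc m μ, -a D ≤ τ0 := by
    intro D hD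
    by_contra hlt
    have hB := ha D (hsubD hD)
    have := hgt (-a D) ⟨(min_le_left _ _).trans_lt (not_le.mp hlt), (hac D hD).trans hc1⟩
    have he : V (-a D) = D := hB.eq
    linarith [hD.2]
  have hosc : ∀ D ∈ Ioc m μ, Osc I V τ0 τ1 D (-a D) (b D) := by
    intro D hD
    have hA := ha D (hsubD hD)
    have hB := hb D (hsubD hD)
    refine ⟨hA.mem, hB.mem, hla D hD, hlb D hD, hA.eq, hB.eq, fun t ht => ?_⟩
    rcases le_total c t with h | h
    · exact hB.gt t ⟨h, ht.2⟩
    · have := hA.gt (-t) ⟨by linarith, by linarith [ht.1]⟩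
      simpa using this
  -- continuity
  have cK : ∀ a b, min τ0 c ≤ a → b ≤ τ1 → ContinuousOn (fun D => Kf V a b D) (Ioc m μ) ∧
      ∀ D ∈ Ioc m μ, Kf V a b D ≠ ∞ := by
    intro a b h h'
    have hss : Ioo a b ⊆ Ioo (min τ0 c) τ1 := Ioo_subset_Ioo h h'
    have hf : Kf V a b μ ≠ ∞ := ne_top_of_le_ne_top hfin (lintegral_mono_set hss)
    have hmI : min τ0 c ∈ I := by rcases min_choice τ0 c with h | h <;> rw [h] <;> assumption
    refine ⟨(Kcont hd (hss.trans (hIoo hmI h1)) hf).mono Ioc_subset_Iic_self, fun D hD => ?_⟩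
    exact ne_top_of_le_ne_top hf (lintegral_mono fun τ => hh_mono V τ hD.2)
  have cB : ContinuousOn (fun D => Kf V c (b D) D) (Ioc m μ) := fun D hD =>
    (Bcont hd hcI hb (hsubD hD)).continuousWithinAt
  have cA : ContinuousOn (fun D => Kf V (-a D) c D) (Ioc m μ) := by
    intro D hD
    have hB := (Bcont hd.neg (show -c ∈ Neg.neg ⁻¹' I by simpa using hcI) ha
      (hsubD hD)).continuousWithinAt (s := Ioc m μ)
    refine hB.congr_of_eventuallyEq (Eventually.of_forall fun D => ?_) ?_
    · have := lneg (-a D) c (fun τ => hh V D τ)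
      rw [neg_neg] at this
      exact this.symm
    · have := lneg (-a D) c (fun τ => hh V D τ)
      rw [neg_neg] at this
      exact this.symm
  have csub : ∀ {F R : ℝ → ℝ≥0∞}, ContinuousOn F (Ioc m μ) → ContinuousOn R (Ioc m μ) →
      (∀ D ∈ Ioc m μ, R D ≠ ∞) → ContinuousOn (fun D => F D - R D) (Ioc m μ) := by
    intro F R hF hR hR' D hD
    exact ENNReal.Tendsto.sub (hF D hD) (hR D hD) (Or.inr (hR' D hD))
  have contE : ContinuousOn (fun D => Kf V τ1 (b D) D) (Ioc m μ) := by
    obtain ⟨p, q⟩ := cK c τ1 (min_le_right _ _) le_rfl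
    refine (csub cB p q).congr (fun D hD => ?_)
    have : Kf V c (b D) D = _ + _ := lsplit hc1.le (hlb D hD) (hh V D)
    simp only
    rw [this]
    exact (ENNReal.add_sub_cancel_left (q D hD)).symm
  have contA : ContinuousOn (fun D => Kf V (-a D) τ0 D) (Ioc m μ) := by
    rcases le_total τ0 c with h | h
    · obtain ⟨p, q⟩ := cK τ0 c (min_le_left _ _) hc1.le
      refine (csub cA p q).congr (fun D hD => ?_)
      have : Kf V (-a D) c D = _ + _ := lsplit (hla D hD) h (hh V D)
      simp only
      rw [this]
      exact (ENNReal.add_sub_cancel_right (q D hD)).symm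
    · obtain ⟨p, q⟩ := cK c τ0 (min_le_right _ _) h01
      refine (cA.add p).congr (fun D hD => ?_)
      exact lsplit (hac D hD).le h (hh V D)
  have contK : ContinuousOn (fun D => Kf V τ0 τ1 D) (Ioc m μ) :=
    (cK τ0 τ1 (min_le_left _ _) le_rfl).1
  have hE0 : Kf V τ1 (b μ) μ = 0 := by
    have hB := hb μ (hsubD hμmem)
    have : b μ ≤ τ1 := by
      by_contra hlt
      have := hB.gt τ1 ⟨hc1.le, not_le.mp hlt⟩
      exact lt_irrefl _ this
    simp [Kf, Ioo_eq_empty (not_lt.mpr this)]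
  have key : ∀ n : ℕ, ∀ D1 ∈ Ioc m μ, ∀ D2 ∈ Ioc m μ,
        Fm n (Kf V (-a D1) τ0 D1) (Kf V τ0 τ1 D1) (Kf V τ1 (b D1) D1) ≤ ENNReal.ofReal L →
        ENNReal.ofReal L ≤ Fm n (Kf V (-a D2) τ0 D2) (Kf V τ0 τ1 D2) (Kf V τ1 (b D2) D2) +
          (Kf V τ1 (b D2) D2 + Kf V τ1 (b D2) D2) → ∃ v v', Flow I V (τ0, v) (τ1, v') L := by
    intro n D1 hD1 D2 hD2 hle hge
    have cF := Fm_cont n contA contK contE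
    have cG := cF.add (contE.add contE)
    have fin : ∀ D ∈ Ioc m μ,
        (Fm n (Kf V (-a D) τ0 D) (Kf V τ0 τ1 D) (Kf V τ1 (b D) D) = ENNReal.ofReal L ∨
        Fm n (Kf V (-a D) τ0 D) (Kf V τ0 τ1 D) (Kf V τ1 (b D) D) +
          (Kf V τ1 (b D) D + Kf V τ1 (b D) D) = ENNReal.ofReal L) →
        ∃ v v', Flow I V (τ0, v) (τ1, v') L := by
      intro D hD h
      have o := hosc D hD
      exact reach' hd hL.le o.la h01 o.lb (hd.ord.out o.ma o.mb) o.gt o.ea o.eb n h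
    rcases le_total (ENNReal.ofReal L)
      (Fm n (Kf V (-a μ) τ0 μ) (Kf V τ0 τ1 μ) (Kf V τ1 (b μ) μ)) with h | h
    · obtain ⟨D, hD, he⟩ := isPreconnected_Ioc.intermediate_value hD1 hμmem cF ⟨hle, h⟩
      exact fin D hD (Or.inl he)
    · obtain ⟨D, hD, he⟩ := isPreconnected_Ioc.intermediate_value hμmem hD2 cG
        ⟨by simpa [hE0] using h, hge⟩
      exact fin D hD (Or.inr he)
  by_cases hbig : ∃ D ∈ Ioc m μ,
      ENNReal.ofReal L < Kf V τ0 τ1 D + (Kf V τ1 (b D) D + Kf V τ1 (b D) D)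
  · left
    obtain ⟨D, hD, h⟩ := hbig
    exact key 0 μ hμmem D hD (by simpa [Fm] using hKL) (by simpa [Fm] using h.le)
  · right
    push Not at hbig
    exact ⟨fun D => -a D, b, hosc, hbig, key⟩

end GC

namespace GC

lemma G_nonneg (f : ℝ → ℝ) (τ : ℝ) : 0 ≤ G f τ := by unfold G; positivity

lemma h_eq (f : ℝ → ℝ) {D τ : ℝ} (hD : D < G f τ) : h f D τ = hh (G f) D τ := by
  rw [hh_eq (G_nonneg f τ) hD, h, mul_inv]
  rfl

lemma h_int (f : ℝ → ℝ) {a b D : ℝ} (hD : ∀ t ∈ Ioo a b, D < G f t) :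
    ∫⁻ τ in Ioo a b, h f D τ = Kf (G f) a b D :=
  setLIntegral_congr_fun measurableSet_Ioo (fun t ht => h_eq f (hD t ht))

lemma bstar_eq {bE : EReal} {f : ℝ → ℝ} {τ0 D β : ℝ} (h1 : τ0 ≤ β) (h2 : (β : EReal) < bE)
    (h3 : G f β = D) (h4 : ∀ t ∈ Ico τ0 β, D < G f t) : bstarR bE f τ0 D = β := by
  apply le_antisymm
  · exact sInf_le (mem_insert_of_mem _ ⟨β, ⟨h1, h2, h3⟩, rfl⟩)
  · refine le_sInf ?_
    rintro _ (rfl | ⟨t, ⟨p, q, r⟩, rfl⟩)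
    · exact h2.le
    · simp only [EReal.coe_le_coe_iff]
      by_contra hlt
      have := h4 t ⟨p, not_le.mp hlt⟩
      linarith

lemma astar_eq {aE : EReal} {f : ℝ → ℝ} {τ0 D α : ℝ} (h1 : α ≤ τ0) (h2 : aE < (α : EReal))
    (h3 : G f α = D) (h4 : ∀ t ∈ Ioc α τ0, D < G f t) : astarR aE f τ0 D = α := by
  apply le_antisymm
  · refine sSup_le ?_
    rintro _ (rfl | ⟨t, ⟨p, q, r⟩, rfl⟩)
    · exact h2.le
    · simp only [EReal.coe_le_coe_iff]
      by_contra hlt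
      have := h4 t ⟨not_le.mp hlt, p⟩
      linarith
  · exact le_sSup (mem_insert_of_mem _ ⟨α, ⟨h1, h2, h3⟩, rfl⟩)

lemma set1 (a b : ℝ) : {τ : ℝ | a < τ ∧ (τ : EReal) < (b : EReal)} = Ioo a b := by
  ext τ; simp
lemma set2 (a b : ℝ) : {τ : ℝ | (a : EReal) < (τ : EReal) ∧ τ < b} = Ioo a b := by
  ext τ; simp
lemma set3 (a b : ℝ) : {τ : ℝ | (a : EReal) < (τ : EReal) ∧ (τ : EReal) < (b : EReal)} = Ioo a b := by
  ext τ; simp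

lemma Fm_alg (n : ℕ) (A K E : ℝ≥0∞) :
    (if Even n then K + E else A) + n * (A + K + E) = Fm n A K E + E := by
  unfold Fm
  rcases Nat.even_or_odd' n with ⟨k, rfl | rfl⟩
  · have : (2 * k) / 2 = k := by omega
    simp only [even_two_mul, if_true, this, nsmul_eq_mul]
    push_cast
    ring
  · have : (2 * k + 1) / 2 = k := by omega
    have hne : ¬ Even (2 * k + 1) := by simp
    simp only [hne, if_false, this, nsmul_eq_mul]
    push_cast
    ring

lemma coeE {x : ℝ≥0∞} (h : x ≠ ∞) : (x : EReal) = ((x.toReal : ℝ) : EReal) :=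
  by lift x to NNReal using h; rfl

lemma arith1 {F E Q : ℝ≥0∞} {L δ : ℝ} (hL : 0 ≤ L) (hδ : 0 ≤ δ) (hQ : Q ≠ ∞)
    (hE : ENNReal.ofReal δ + Q ≤ E)
    (h : ((F + E : ℝ≥0∞) : EReal) - (Q : EReal) < ((L + δ : ℝ) : EReal)) : F ≤ ENNReal.ofReal L := by
  by_contra hlt
  rw [not_le] at hlt
  have h1 : ENNReal.ofReal (L + δ) + Q ≤ F + E := by
    rw [ENNReal.ofReal_add hL hδ, add_assoc]
    exact add_le_add hlt.le hE
  have hfin : ENNReal.ofReal (L + δ) + Q ≠ ∞ := by simp [hQ]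
  have h2 : ((ENNReal.ofReal (L + δ) + Q : ℝ≥0∞) : EReal) - (Q : EReal) < ((L + δ : ℝ) : EReal) :=
    lt_of_le_of_lt (EReal.sub_le_sub (by exact_mod_cast h1) le_rfl) h
  rw [coeE hfin, coeE hQ, ← EReal.coe_sub, EReal.coe_lt_coe_iff,
    ENNReal.toReal_add (by simp) hQ, ENNReal.toReal_ofReal (by linarith)] at h2
  linarith

lemma arith2 {F E Q : ℝ≥0∞} {L δ : ℝ} (hδ : 0 ≤ δ)
    (hE : ENNReal.ofReal δ + Q ≤ E)
    (h : ((L - δ : ℝ) : EReal) < ((F + E : ℝ≥0∞) : EReal) + (Q : EReal)) :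
    ENNReal.ofReal L ≤ F + (E + E) := by
  by_contra hlt
  rw [not_le] at hlt
  have h1 : ENNReal.ofReal δ + (F + E + Q) < ENNReal.ofReal L := by
    refine lt_of_le_of_lt ?_ hlt
    calc ENNReal.ofReal δ + (F + E + Q) = F + (E + (ENNReal.ofReal δ + Q)) := by ring
      _ ≤ _ := by gcongr
  have hfin : F + E + Q ≠ ∞ := by
    have := ne_top_of_lt h1
    rw [ENNReal.add_ne_top] at this
    exact this.2
  rw [← EReal.coe_ennreal_add, coeE hfin, EReal.coe_lt_coe_iff] at h
  have h3 := (ENNReal.lt_ofReal_iff_toReal_lt (by simp [hfin])).mp h1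
  rw [ENNReal.toReal_add (by simp) hfin, ENNReal.toReal_ofReal hδ] at h3
  linarith

lemma bEnd_lt {aE bE : EReal} (hab : aE < bE) {ε : ℝ} (hε : 0 < ε) : (bEnd bE ε : EReal) < bE := by
  unfold bEnd
  split_ifs with h
  · rw [h]; exact EReal.coe_lt_top _
  · have hb : bE ≠ ⊥ := (bot_le.trans_lt hab).ne'
    conv_rhs => rw [← EReal.coe_toReal h hb]
    rw [EReal.coe_lt_coe_iff]; linarith

lemma bEnd_gt {aE bE : EReal} (hab : aE < bE) {τ : ℝ} (hτ : (τ : EReal) < bE) :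
    ∃ ε : ℝ, 0 < ε ∧ τ < bEnd bE ε := by
  unfold bEnd
  split_ifs with h
  · refine ⟨(|τ| + 1)⁻¹, by positivity, ?_⟩
    rw [inv_inv]; linarith [le_abs_self τ]
  · have hb : bE ≠ ⊥ := (bot_le.trans_lt hab).ne'
    rw [← EReal.coe_toReal h hb, EReal.coe_lt_coe_iff] at hτ
    exact ⟨(bE.toReal - τ) / 2, by linarith, by linarith⟩

lemma K_lower {I : Set ℝ} {V : ℝ → ℝ} (hd : Dat I V) {m c d : ℝ} (hcd : c < d)
    (hI : Icc c d ⊆ I) (hm : ∀ τ ∈ Icc c d, m < V τ) :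
    ∃ δ : ℝ, 0 < δ ∧ ∀ D ≥ m, ENNReal.ofReal δ ≤ Kf V c d D := by
  have hfin : Kf V c d m ≠ ∞ := Kfin hd hI hm
  have hpos : 0 < Kf V c d m := by
    obtain ⟨z, hz, hz'⟩ := exists_min hd hcd.le hI
    obtain ⟨y, hy, hy'⟩ := exists_maxV hd hcd.le hI
    have hle : ∫⁻ τ in Ioo c d, ENNReal.ofReal (V z) * (ENNReal.ofReal (√(V y - m)))⁻¹ ≤ Kf V c d m := by
      refine setLIntegral_mono' measurableSet_Ioo (fun τ hτ => ?_)
      have h1 := hz' τ (Ioo_subset_Icc_self hτ)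
      have h2 := hy' τ (Ioo_subset_Icc_self hτ)
      unfold hh
      gcongr
    refine lt_of_lt_of_le ?_ hle
    rw [setLIntegral_const]
    have h3 := hd.pos z (hI hz)
    refine ENNReal.mul_pos (ENNReal.mul_pos ?_ ?_).ne' ?_
    · simpa using h3
    · simp
    · simpa using hcd
  refine ⟨(Kf V c d m).toReal, ENNReal.toReal_pos hpos.ne' hfin, fun D hD => ?_⟩
  rw [ENNReal.ofReal_toReal hfin]
  exact lintegral_mono fun τ => hh_mono V τ hD

lemma half {aE bE : EReal} (hab : aE < bE) {f : ℝ → ℝ} (hd : Dat (II aE bE) (G f)) {τ0 τ1 L : ℝ}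
    (hm : ∀ τ ∈ II aE bE, mGlob aE bE f < G f τ)
    (h2 : ∀ D > mGlob aE bE f, ∀ s ∈ II aE bE, ∃ τ ∈ II aE bE, s < τ ∧ G f τ < D)
    (h3 : ∀ D > mGlob aE bE f, ∀ s ∈ II aE bE, ∃ τ ∈ II aE bE, τ < s ∧ G f τ < D)
    {d : ℝ≥0∞} (h4 : Icc (rI aE bE f τ0 0) (d : EReal) ⊆
        ⋃ n : ℕ, Icc (rI aE bE f τ0 n) (rS aE bE f τ0 n))
    (hLd : (L : EReal) ≤ (d : EReal))
    (h0 : τ0 ∈ II aE bE) (h1 : τ1 ∈ II aE bE) (h01 : τ0 ≤ τ1)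
    (hμ : ∀ τ ∈ Icc τ0 τ1, G f τ1 ≤ G f τ)
    (hcase : τ0 < τ1 ∨ (τ0 = τ1 ∧ deriv (G f) τ1 < 0)) (hL : 0 < L) :
    ∃ v v', Flow (II aE bE) (G f) (τ0, v) (τ1, v') L := by
  rcases core hd hm h2 h3 h0 h1 h01 hμ hcase hL with hF | ⟨α, β, hosc, hK, key⟩
  · exact hF
  set m := mGlob aE bE f with hmdef
  set V := G f with hV
  have hmμ : m < V τ1 := hm τ1 h1
  have sub : Ioo m (V τ1) ⊆ Ioc m (V τ1) := Ioo_subset_Ioc_self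
  have hb : ∀ D ∈ Ioo m (V τ1), bstarR bE f τ0 D = β D := by
    intro D hD
    have o := hosc D (sub hD)
    refine bstar_eq (h01.trans o.lb) o.mb.2 o.eb (fun t ht => ?_)
    rcases (o.la.trans ht.1).lt_or_eq with h | h
    · exact o.gt t ⟨h, ht.2⟩
    · have e : t = τ0 := le_antisymm (h ▸ o.la) ht.1
      rw [e]; exact hD.2.trans_le (hμ τ0 ⟨le_rfl, h01⟩)
  have ha : ∀ D ∈ Ioo m (V τ1), astarR aE f τ0 D = α D := by
    intro D hD
    have o := hosc D (sub hD)
    refine astar_eq o.la o.ma.1 o.ea (fun t ht => ?_)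
    rcases (ht.2.trans (h01.trans o.lb)).lt_or_eq with h | h
    · exact o.gt t ⟨ht.1, h⟩
    · have e : t = τ0 := le_antisymm ht.2 (h ▸ (h01.trans o.lb))
      rw [e]; exact hD.2.trans_le (hμ τ0 ⟨le_rfl, h01⟩)
  have hX : ∀ n : ℕ, ∀ D ∈ Ioo m (V τ1), CInt aE bE f τ0 n D + n * TInt aE bE f τ0 D =
      Fm n (Kf V (α D) τ0 D) (Kf V τ0 τ1 D) (Kf V τ1 (β D) D) + Kf V τ1 (β D) D := by
    intro n D hD
    have o := hosc D (sub hD)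
    have eB : BInt bE f τ0 D = Kf V τ0 τ1 D + Kf V τ1 (β D) D := by
      unfold BInt
      rw [hb D hD, set1, h_int f (fun t ht => o.gt t ⟨o.la.trans_lt ht.1, ht.2⟩)]
      exact lsplit h01 o.lb _
    have eA : AInt aE f τ0 D = Kf V (α D) τ0 D := by
      unfold AInt
      rw [ha D hD, set2, h_int f (fun t ht => o.gt t ⟨ht.1, ht.2.trans_le (h01.trans o.lb)⟩)]
    have eT : TInt aE bE f τ0 D = Kf V (α D) τ0 D + Kf V τ0 τ1 D + Kf V τ1 (β D) D := by
      unfold TInt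
      rw [ha D hD, hb D hD, set3, h_int f o.gt, add_assoc]
      rw [show Kf V τ0 τ1 D + Kf V τ1 (β D) D = Kf V τ0 (β D) D from (lsplit h01 o.lb _).symm]
      exact lsplit o.la (h01.trans o.lb) _
    rw [← Fm_alg, ← eT]
    unfold CInt
    rw [eB, eA]
  have hev : ∀ᶠ D in 𝓝[>] m, D ∈ Ioo m (V τ1) := Ioo_mem_nhdsGT hmμ
  have hQev : ∀ s : ℝ, (s : EReal) < bE → ∀ᶠ D in 𝓝[>] m, s ≤ β D := by
    intro s hs
    rcases le_total s τ0 with h | h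
    · filter_upwards [hev] with D hD
      have o := hosc D (sub hD)
      exact h.trans (h01.trans o.lb)
    · have hsI : s ∈ II aE bE := ⟨h0.1.trans_le (by exact_mod_cast h), hs⟩
      have hI : Icc τ0 s ⊆ II aE bE := hd.ord.out h0 hsI
      obtain ⟨z, hz, hz'⟩ := exists_min hd h hI
      filter_upwards [hev, Ioo_mem_nhdsGT (hm z (hI hz))] with D hD hDz
      have o := hosc D (sub hD)
      by_contra hle
      have := hz' (β D) ⟨h01.trans o.lb, (not_le.mp hle).le⟩
      have e := o.eb
      have := hDz.2
      linarith
  have hr0 : rI aE bE f τ0 0 ≤ (L : EReal) := by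
    unfold rI
    refine iSup_le fun ε => ?_
    have : ∀ᶠ D in 𝓝[>] m, ((CInt aE bE f τ0 0 D + (0 : ℕ) * TInt aE bE f τ0 D : ℝ≥0∞) : EReal)
          - QInt bE f τ0 D ε.1 ≤ (L : EReal) := by
      filter_upwards [hev, hQev _ (bEnd_lt hab ε.2)] with D hD hq
      have hQ0 : 0 ≤ QInt bE f τ0 D ε.1 := by
        unfold QInt
        rw [hb D hD, if_pos (by exact_mod_cast hq)]
        exact EReal.coe_ennreal_nonneg _
      have hle : CInt aE bE f τ0 0 D + (0 : ℕ) * TInt aE bE f τ0 D ≤ ENNReal.ofReal L := by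
        rw [hX 0 D hD]
        refine le_trans ?_ (hK D (sub hD))
        simp only [Fm, Even.zero, if_true, Nat.zero_div, zero_smul, zero_add]
        rw [← add_assoc]
        exact le_self_add
      calc _ ≤ ((CInt aE bE f τ0 0 D + (0 : ℕ) * TInt aE bE f τ0 D : ℝ≥0∞) : EReal) - 0 :=
            EReal.sub_le_sub le_rfl hQ0
        _ ≤ ((ENNReal.ofReal L : ℝ≥0∞) : EReal) := by
            rw [sub_zero]; exact_mod_cast hle
        _ = (L : EReal) := by
            rw [EReal.coe_ennreal_ofReal, max_eq_left hL.le]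
    exact (liminf_le_liminf this).trans (liminf_const (f := 𝓝[>] m) (L : EReal)).le
  obtain ⟨n, hn1, hn2⟩ := mem_iUnion.mp (h4 ⟨hr0, hLd⟩)
  obtain ⟨ε, hε, hsε⟩ := bEnd_gt hab h1.2
  have hsb := bEnd_lt hab hε
  set s := bEnd bE ε with hs
  have hsI : s ∈ II aE bE := ⟨h1.1.trans (by exact_mod_cast hsε), hsb⟩
  have hIs : Icc τ1 s ⊆ II aE bE := hd.ord.out h1 hsI
  obtain ⟨δ, hδ, hδ'⟩ := K_lower hd hsε hIs (fun τ hτ => hm τ (hIs hτ))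
  have hQ : ∀ᶠ D in 𝓝[>] m, D ∈ Ioo m (V τ1) ∧ Kf V s (β D) D ≠ ∞ ∧
      QInt bE f τ0 D ε = (Kf V s (β D) D : EReal) ∧
      ENNReal.ofReal δ + Kf V s (β D) D ≤ Kf V τ1 (β D) D := by
    filter_upwards [hev, hQev s hsb] with D hD hq
    have o := hosc D (sub hD)
    have hsp : Kf V τ1 (β D) D = Kf V τ1 s D + Kf V s (β D) D := lsplit hsε.le hq _
    refine ⟨hD, ?_, ?_, ?_⟩
    · refine ne_top_of_le_ne_top ENNReal.ofReal_ne_top (le_trans ?_ (hK D (sub hD)))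
      rw [hsp]
      calc Kf V s (β D) D ≤ Kf V τ1 s D + Kf V s (β D) D := le_add_self
        _ ≤ (Kf V τ1 s D + Kf V s (β D) D) + (Kf V τ1 s D + Kf V s (β D) D) := le_self_add
        _ ≤ _ := le_add_self
    · unfold QInt
      rw [hb D hD, if_pos (by exact_mod_cast hq), ← hs, set1, h_int f (fun t ht => o.gt t
        ⟨(o.la.trans (h01.trans hsε.le)).trans_lt ht.1, ht.2⟩)]
    · rw [hsp]
      exact add_le_add (hδ' D hD.1.le) le_rfl
  have f1 : ∃ᶠ D in 𝓝[>] m, ((CInt aE bE f τ0 n D + n * TInt aE bE f τ0 D : ℝ≥0∞) : EReal)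
          - QInt bE f τ0 D ε < ((L + δ : ℝ) : EReal) := by
    refine frequently_lt_of_liminf_lt (by isBoundedDefault) ?_
    have : _ ≤ rI aE bE f τ0 n := le_iSup (fun ε : {e : ℝ // 0 < e} => liminf (fun D =>
        ((CInt aE bE f τ0 n D + n * TInt aE bE f τ0 D : ℝ≥0∞) : EReal)
          - QInt bE f τ0 D ε.1) (𝓝[>] (mGlob aE bE f))) ⟨ε, hε⟩
    exact (this.trans hn1).trans_lt (by rw [EReal.coe_lt_coe_iff]; linarith)
  have f2 : ∃ᶠ D in 𝓝[>] m, ((L - δ : ℝ) : EReal) <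
      ((CInt aE bE f τ0 n D + n * TInt aE bE f τ0 D : ℝ≥0∞) : EReal)
          + QInt bE f τ0 D ε := by
    refine frequently_lt_of_lt_limsup (by isBoundedDefault) ?_
    have : rS aE bE f τ0 n ≤ _ := iInf_le (fun ε : {e : ℝ // 0 < e} => limsup (fun D =>
        ((CInt aE bE f τ0 n D + n * TInt aE bE f τ0 D : ℝ≥0∞) : EReal)
          + QInt bE f τ0 D ε.1) (𝓝[>] (mGlob aE bE f))) ⟨ε, hε⟩
    exact lt_of_lt_of_le (by rw [EReal.coe_lt_coe_iff]; linarith) (hn2.trans this)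
  obtain ⟨D1, e1, g1, g2, g3, g4⟩ := (f1.and_eventually hQ).exists
  obtain ⟨D2, e2, k1, k2, k3, k4⟩ := (f2.and_eventually hQ).exists
  rw [hX n D1 g1, g3] at e1
  rw [hX n D2 k1, k3] at e2
  exact key n D1 (sub g1) D2 (sub k1) (arith1 hL.le hδ.le g2 g4 e1) (arith2 hδ.le k4 e2)

end GC

namespace GC

def fn (f : ℝ → ℝ) : ℝ → ℝ := fun t => f (-t)

lemma II_neg (aE bE : EReal) : II (-bE) (-aE) = Neg.neg ⁻¹' II aE bE := by
  ext t
  simp only [II, mem_setOf_eq, mem_preimage, EReal.coe_neg]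
  rw [EReal.neg_lt_comm, EReal.lt_neg_comm (b := aE)]
  tauto

lemma lneg' (S : Set ℝ) (g : ℝ → ℝ≥0∞) : ∫⁻ τ in Neg.neg ⁻¹' S, g (-τ) = ∫⁻ τ in S, g τ :=
  (Measure.measurePreserving_neg (volume : Measure ℝ)).setLIntegral_comp_preimage_emb
    (MeasurableEquiv.neg ℝ).measurableEmbedding g S

lemma bstar_neg (aE : EReal) (f : ℝ → ℝ) (τ0 D : ℝ) :
    bstarR (-aE) (fn f) (-τ0) D = -astarR aE f τ0 D := by
  apply le_antisymm
  · rw [EReal.le_neg]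
    refine sSup_le ?_
    rintro _ (rfl | ⟨t, ⟨p, q, r⟩, rfl⟩)
    · rw [EReal.le_neg]; exact sInf_le (mem_insert _ _)
    · rw [EReal.le_neg]
      refine sInf_le (mem_insert_of_mem _ ⟨-t, ⟨by linarith, by simpa using q, ?_⟩, by simp⟩)
      simpa [G, fn] using r
  · refine le_sInf ?_
    rintro _ (rfl | ⟨t, ⟨p, q, r⟩, rfl⟩)
    · rw [EReal.neg_le_neg_iff]; exact le_sSup (mem_insert _ _)
    · rw [EReal.neg_le]
      refine le_sSup (mem_insert_of_mem _ ⟨-t, ⟨by linarith, ?_, r⟩, by simp⟩)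
      rw [EReal.coe_neg]; exact EReal.lt_neg_comm.mp q

lemma astar_neg (bE : EReal) (f : ℝ → ℝ) (τ0 D : ℝ) :
    astarR (-bE) (fn f) (-τ0) D = -bstarR bE f τ0 D := by
  have := bstar_neg (-bE) (fn f) (-τ0) D
  have e : fn (fn f) = f := by funext t; simp [fn]
  rw [e, neg_neg, neg_neg] at this
  rw [this, neg_neg]

lemma h_neg (f : ℝ → ℝ) (D τ : ℝ) : h (fn f) D τ = h f D (-τ) := rfl

lemma setL (S T : Set ℝ) (f : ℝ → ℝ) (D : ℝ) (hST : ∀ τ, τ ∈ T ↔ -τ ∈ S) :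
    ∫⁻ τ in T, h (fn f) D τ = ∫⁻ τ in S, h f D τ := by
  have : T = Neg.neg ⁻¹' S := by ext τ; exact hST τ
  rw [this]
  exact lneg' S (fun τ => h f D τ)

lemma B_neg (aE : EReal) (f : ℝ → ℝ) (τ0 D : ℝ) :
    BInt (-aE) (fn f) (-τ0) D = AInt aE f τ0 D := by
  unfold BInt AInt
  rw [bstar_neg]
  apply setL
  intro τ
  simp only [mem_setOf_eq, EReal.coe_neg]
  rw [EReal.lt_neg_comm (b := astarR aE f τ0 D), neg_lt]
  tauto

lemma A_neg (bE : EReal) (f : ℝ → ℝ) (τ0 D : ℝ) :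
    AInt (-bE) (fn f) (-τ0) D = BInt bE f τ0 D := by
  unfold BInt AInt
  rw [astar_neg]
  apply setL
  intro τ
  simp only [mem_setOf_eq, EReal.coe_neg]
  rw [EReal.neg_lt_comm, lt_neg]
  tauto

lemma T_neg (aE bE : EReal) (f : ℝ → ℝ) (τ0 D : ℝ) :
    TInt (-bE) (-aE) (fn f) (-τ0) D = TInt aE bE f τ0 D := by
  unfold TInt
  rw [astar_neg, bstar_neg]
  apply setL
  intro τ
  simp only [mem_setOf_eq, EReal.coe_neg]
  rw [EReal.neg_lt_comm, EReal.lt_neg_comm (b := astarR aE f τ0 D)]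
  tauto

lemma End_neg (aE : EReal) (ε : ℝ) : bEnd (-aE) ε = -aEnd aE ε := by
  unfold bEnd aEnd
  by_cases h : aE = ⊥
  · simp [h]
  · have : ¬ (-aE = ⊤) := by simpa using h
    rw [if_neg h, if_neg this, EReal.toReal_neg_eq]
    ring

lemma Q_neg (aE : EReal) (f : ℝ → ℝ) (τ0 D ε : ℝ) :
    QInt (-aE) (fn f) (-τ0) D ε = QInt' aE f τ0 D ε := by
  unfold QInt QInt'
  rw [bstar_neg, End_neg]
  have e : ((-aEnd aE ε : ℝ) : EReal) ≤ -astarR aE f τ0 D ↔ astarR aE f τ0 D ≤ ((aEnd aE ε : ℝ) : EReal) := by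
    rw [EReal.coe_neg, EReal.neg_le_neg_iff]
  by_cases hc : astarR aE f τ0 D ≤ ((aEnd aE ε : ℝ) : EReal)
  · rw [if_pos hc, if_pos (e.2 hc)]
    congr 1
    apply setL
    intro τ
    simp only [mem_setOf_eq, EReal.coe_neg]
    rw [EReal.lt_neg_comm (b := astarR aE f τ0 D), neg_lt]
    tauto
  · rw [if_neg hc, if_neg (fun h => hc (e.1 h))]
    congr 2
    apply setL
    intro τ
    simp only [mem_setOf_eq, EReal.coe_neg]
    rw [EReal.neg_lt_comm, lt_neg]
    tauto

lemma m_neg (aE bE : EReal) (f : ℝ → ℝ) : mGlob (-bE) (-aE) (fn f) = mGlob aE bE f := by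
  unfold mGlob
  congr 1
  rw [II_neg]
  ext y
  constructor
  · rintro ⟨t, ht, rfl⟩; exact ⟨-t, ht, rfl⟩
  · rintro ⟨t, ht, rfl⟩; exact ⟨-t, by simpa using ht, by simp [G, fn]⟩

lemma C_neg (aE bE : EReal) (f : ℝ → ℝ) (τ0 : ℝ) (n : ℕ) (D : ℝ) :
    CInt (-bE) (-aE) (fn f) (-τ0) n D = CInt' aE bE f τ0 n D := by
  unfold CInt CInt'
  rw [A_neg, B_neg]

lemma rI_neg (aE bE : EReal) (f : ℝ → ℝ) (τ0 : ℝ) (n : ℕ) :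
    rI (-bE) (-aE) (fn f) (-τ0) n = lI aE bE f τ0 n := by
  unfold rI lI
  simp only [C_neg, T_neg, Q_neg, m_neg]

lemma rS_neg (aE bE : EReal) (f : ℝ → ℝ) (τ0 : ℝ) (n : ℕ) :
    rS (-bE) (-aE) (fn f) (-τ0) n = lS aE bE f τ0 n := by
  unfold rS lS
  simp only [C_neg, T_neg, Q_neg, m_neg]

lemma halfL {aE bE : EReal} (hab : aE < bE) {f : ℝ → ℝ} (hd : Dat (II aE bE) (G f)) {τ0 τ1 L : ℝ}
    (hm : ∀ τ ∈ II aE bE, mGlob aE bE f < G f τ)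
    (h2 : ∀ D > mGlob aE bE f, ∀ s ∈ II aE bE, ∃ τ ∈ II aE bE, s < τ ∧ G f τ < D)
    (h3 : ∀ D > mGlob aE bE f, ∀ s ∈ II aE bE, ∃ τ ∈ II aE bE, τ < s ∧ G f τ < D)
    {d : ℝ≥0∞} (h4 : Icc (lI aE bE f τ0 0) (d : EReal) ⊆
        ⋃ n : ℕ, Icc (lI aE bE f τ0 n) (lS aE bE f τ0 n))
    (hLd : (L : EReal) ≤ (d : EReal))
    (h0 : τ0 ∈ II aE bE) (h1 : τ1 ∈ II aE bE) (h01 : τ1 ≤ τ0)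
    (hμ : ∀ τ ∈ Icc τ1 τ0, G f τ1 ≤ G f τ)
    (hcase : τ1 < τ0 ∨ (τ1 = τ0 ∧ 0 < deriv (G f) τ1)) (hL : 0 < L) :
    ∃ v v', Flow (II aE bE) (G f) (τ0, v) (τ1, v') L := by
  have hG : G (fn f) = fun t => G f (-t) := rfl
  have hN : ∀ t, t ∈ II (-bE) (-aE) ↔ -t ∈ II aE bE := by intro t; rw [II_neg]; rfl
  have hdn : Dat (II (-bE) (-aE)) (G (fn f)) := by
    rw [II_neg]; exact hd.neg
  have := half (aE := -bE) (bE := -aE) (EReal.neg_lt_neg_iff.mpr hab) hdn (τ0 := -τ0) (τ1 := -τ1)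
    (L := L) (d := d) ?_ ?_ ?_ ?_ hLd ?_ ?_ ?_ ?_ ?_ hL
  · obtain ⟨v, v', hF⟩ := this
    have := hF.neg
    simp only [II_neg] at this
    have e1 : Neg.neg ⁻¹' (Neg.neg ⁻¹' II aE bE) = II aE bE := by
      ext t; simp
    have e2 : (fun t => G (fn f) (-t)) = G f := by
      funext t; simp [G, fn]
    rw [e1, e2, neg_neg, neg_neg] at this
    exact ⟨_, _, this⟩
  · intro τ hτ
    rw [m_neg]; exact hm _ ((hN τ).mp hτ)
  · intro D hD s hs
    rw [m_neg] at hD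
    obtain ⟨τ, p, q, r⟩ := h3 D hD _ ((hN s).mp hs)
    exact ⟨-τ, (hN _).mpr (by simpa using p), by linarith, by rw [hG]; simpa using r⟩
  · intro D hD s hs
    rw [m_neg] at hD
    obtain ⟨τ, p, q, r⟩ := h2 D hD _ ((hN s).mp hs)
    exact ⟨-τ, (hN _).mpr (by simpa using p), by linarith, by rw [hG]; simpa using r⟩
  · simpa only [rI_neg, rS_neg] using h4
  · exact (hN _).mpr (by simpa using h0)
  · exact (hN _).mpr (by simpa using h1)
  · linarith
  · intro τ hτ
    rw [hG]
    simp only [neg_neg]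
    exact hμ (-τ) ⟨by linarith [hτ.2], by linarith [hτ.1]⟩
  · rcases hcase with h | ⟨h, h'⟩
    · left; linarith
    · right
      refine ⟨by rw [h], ?_⟩
      rw [hG, deriv_comp_neg, neg_neg]
      linarith

end GC

namespace GC

lemma mkDat {aE bE : EReal} {f : ℝ → ℝ}
    (hf : ContDiffOn ℝ (⊤ : ℕ∞) f (II aE bE)) (hfpos : ∀ τ ∈ II aE bE, 0 < f τ) :
    Dat (II aE bE) (G f) where
  opn := by
    have : II aE bE = (fun τ : ℝ => (τ : EReal)) ⁻¹' Ioo aE bE := rfl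
    rw [this]
    exact isOpen_Ioo.preimage continuous_coe_real_ereal
  ord := by
    refine ⟨fun x hx y hy z hz => ⟨hx.1.trans_le ?_, lt_of_le_of_lt ?_ hy.2⟩⟩
    · exact_mod_cast hz.1
    · exact_mod_cast hz.2
  smooth := by
    have h2 : ContDiffOn ℝ 2 f (II aE bE) := hf.of_le (WithTop.coe_le_coe.mpr (le_top : (2 : ℕ∞) ≤ ⊤))
    exact (h2.pow 2).inv (fun τ hτ => (pow_pos (hfpos τ hτ) 2).ne')
  pos := fun τ hτ => by
    have := hfpos τ hτ
    unfold G; positivity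

lemma mB_ex {aE bE : EReal} {f : ℝ → ℝ} {m : ℝ} (h : mB bE f = (m : EReal)) :
    ∀ D > m, ∀ s ∈ II aE bE, ∃ τ ∈ II aE bE, s < τ ∧ G f τ < D := by
  intro D hD s hs
  have h1 : ∃ᶠ τ in Fb bE, ((G f τ : ℝ) : EReal) < (D : EReal) := by
    refine frequently_lt_of_liminf_lt (by isBoundedDefault) ?_
    have : mB bE f < (D : EReal) := by rw [h]; exact_mod_cast hD
    exact this
  have h2 : ∀ᶠ τ : ℝ in Fb bE, (s : EReal) < (τ : EReal) ∧ (τ : EReal) < bE :=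
    preimage_mem_comap (Ioo_mem_nhdsLT hs.2)
  obtain ⟨τ, p, q, r⟩ := (h1.and_eventually h2).exists
  exact ⟨τ, ⟨hs.1.trans q, r⟩, by exact_mod_cast q, by exact_mod_cast p⟩

lemma mA_ex {aE bE : EReal} {f : ℝ → ℝ} {m : ℝ} (h : mA aE f = (m : EReal)) :
    ∀ D > m, ∀ s ∈ II aE bE, ∃ τ ∈ II aE bE, τ < s ∧ G f τ < D := by
  intro D hD s hs
  have h1 : ∃ᶠ τ in Fa aE, ((G f τ : ℝ) : EReal) < (D : EReal) := by
    refine frequently_lt_of_liminf_lt (by isBoundedDefault) ?_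
    have : mA aE f < (D : EReal) := by rw [h]; exact_mod_cast hD
    exact this
  have h2 : ∀ᶠ τ : ℝ in Fa aE, aE < (τ : EReal) ∧ (τ : EReal) < (s : EReal) :=
    preimage_mem_comap (Ioo_mem_nhdsGT hs.1)
  obtain ⟨τ, p, q, r⟩ := (h1.and_eventually h2).exists
  exact ⟨τ, ⟨q, r.trans hs.2⟩, by exact_mod_cast r, by exact_mod_cast p⟩

lemma c2 {t1 : ℝ} (ht : 0 < t1) {u u' u'' : ℝ → ℝ}
    (h1 : ∀ t ∈ Icc 0 t1, HasDerivWithinAt u (u' t) (Icc 0 t1) t)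
    (h2 : ∀ t ∈ Icc 0 t1, HasDerivWithinAt u' (u'' t) (Icc 0 t1) t)
    (h3 : ContinuousOn u'' (Icc 0 t1)) :
    ContDiffOn ℝ 2 u (Icc 0 t1) ∧ (∀ t ∈ Icc 0 t1, derivWithin u (Icc 0 t1) t = u' t) ∧
      ∀ t ∈ Icc 0 t1, derivWithin (derivWithin u (Icc 0 t1)) (Icc 0 t1) t = u'' t := by
  have hu := uniqueDiffOn_Icc ht
  have e1 : ∀ t ∈ Icc 0 t1, derivWithin u (Icc 0 t1) t = u' t := fun t h => (h1 t h).derivWithin (hu t h)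
  have e2 : ∀ t ∈ Icc 0 t1, derivWithin u' (Icc 0 t1) t = u'' t := fun t h => (h2 t h).derivWithin (hu t h)
  have c1 : ContDiffOn ℝ 1 u' (Icc 0 t1) := by
    rw [show (1 : WithTop ℕ∞) = 0 + 1 by norm_num, contDiffOn_succ_iff_derivWithin hu]
    refine ⟨fun t h => (h2 t h).differentiableWithinAt, by simp, ?_⟩
    rw [contDiffOn_zero]
    exact h3.congr e2
  refine ⟨?_, e1, fun t h => ?_⟩
  · rw [show (2 : WithTop ℕ∞) = 1 + 1 by norm_num, contDiffOn_succ_iff_derivWithin hu]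
    refine ⟨fun t h => (h1 t h).differentiableWithinAt, by simp, c1.congr e1⟩
  · rw [derivWithin_congr e1 (e1 t h), e2 t h]

lemma mkGeo {aE bE : EReal} {f : ℝ → ℝ} {J : Set ℝ} {t1 : ℝ} (ht : 0 < t1)
    {σ w w' x y y' : ℝ → ℝ}
    (hσ : ∀ t ∈ Icc 0 t1, HasDerivWithinAt σ (w t) (Icc 0 t1) t)
    (hw : ∀ t ∈ Icc 0 t1, HasDerivWithinAt w (w' t) (Icc 0 t1) t)
    (hx : ∀ t ∈ Icc 0 t1, HasDerivWithinAt x (y t) (Icc 0 t1) t)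
    (hy : ∀ t ∈ Icc 0 t1, HasDerivWithinAt y (y' t) (Icc 0 t1) t)
    (cw : ContinuousOn w' (Icc 0 t1)) (cy : ContinuousOn y' (Icc 0 t1))
    (hI : ∀ t ∈ Icc 0 t1, σ t ∈ II aE bE) (hJ : ∀ t ∈ Icc 0 t1, x t ∈ J)
    (e1 : ∀ t ∈ Icc 0 t1, w' t = -(f (σ t) * deriv f (σ t) * (y t) ^ 2))
    (e2 : ∀ t ∈ Icc 0 t1, y' t = -(2 * (deriv f (σ t) / f (σ t)) * w t * y t)) :
    IsGeodesicOn aE bE f J σ x 0 t1 := by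
  obtain ⟨a1, a2, a3⟩ := c2 ht hσ hw cw
  obtain ⟨b1, b2, b3⟩ := c2 ht hx hy cy
  refine ⟨hI, hJ, a1, b1, fun t h => ?_, fun t h => ?_⟩
  · rw [a3 t h, b2 t h, e1 t h]
  · rw [b3 t h, a2 t h, b2 t h, e2 t h]

lemma G_deriv {aE bE : EReal} {f : ℝ → ℝ} (hd : Dat (II aE bE) (G f))
    (hf : ContDiffOn ℝ (⊤ : ℕ∞) f (II aE bE)) (hfpos : ∀ τ ∈ II aE bE, 0 < f τ) {τ : ℝ}
    (hτ : τ ∈ II aE bE) : deriv (G f) τ = -(2 * deriv f τ / f τ ^ 3) := by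
  have h1 : HasDerivAt f (deriv f τ) τ :=
    ((hf.differentiableOn (by simp) τ hτ).differentiableAt (hd.opn.mem_nhds hτ)).hasDerivAt
  have hp := hfpos τ hτ
  have h2 := (h1.pow 2).inv (by simpa using hp.ne')
  have h3 : HasDerivAt (G f) _ τ := h2
  rw [h3.deriv]
  simp only [Pi.pow_apply]
  field_simp
  norm_num
  ring

lemma geo_of_flow {aE bE : EReal} {f : ℝ → ℝ} (hd : Dat (II aE bE) (G f))
    (hf : ContDiffOn ℝ (⊤ : ℕ∞) f (II aE bE)) (hfpos : ∀ τ ∈ II aE bE, 0 < f τ)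
    {J : Set ℝ} (hJ : OrdConnected J) {τ0 τ1 x0 x1 v v' L s : ℝ} (hL : 0 < L) (hs : s ^ 2 = 1)
    (hx0 : x0 ∈ J) (hx1 : x1 ∈ J) (hx : x1 = x0 + s * L)
    (hF : Flow (II aE bE) (G f) (τ0, v) (τ1, v') L) :
    ∃ (σ x : ℝ → ℝ) (t1 : ℝ), 0 ≤ t1 ∧ IsGeodesicOn aE bE f J σ x 0 t1 ∧
      σ 0 = τ0 ∧ x 0 = x0 ∧ σ t1 = τ1 ∧ x t1 = x1 := by
  obtain ⟨t1, σ, w, x, ht, a1, a2, a3, a4, a5, a6, hall⟩ := hF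
  have ht1 : 0 < t1 := by
    rcases ht.lt_or_eq with h | h
    · exact h
    · rw [← h, a3] at a6; exact absurd a6 hL.ne
  have hσc : ContinuousOn σ (Icc 0 t1) := fun t h => (hall t h).2.1.continuousWithinAt
  have hwc : ContinuousOn w (Icc 0 t1) := fun t h => (hall t h).2.2.1.continuousWithinAt
  have hxc : ContinuousOn x (Icc 0 t1) := fun t h => (hall t h).2.2.2.continuousWithinAt
  have hV'c : ContinuousOn (fun t => deriv (G f) (σ t)) (Icc 0 t1) :=
    hd.contDeriv.comp hσc (fun t h => (hall t h).1)
  have hmono : MonotoneOn x (Icc 0 t1) := by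
    refine monotoneOn_of_hasDerivWithinAt_nonneg (f' := fun t => G f (σ t)) (convex_Icc 0 t1) hxc ?_ ?_
    · intro t h
      exact (hall t (interior_subset h)).2.2.2.mono interior_subset
    · intro t h
      exact G_nonneg f _
  refine ⟨σ, fun t => x0 + s * x t, t1, ht, ?_, a1, by simp [a3], a4, by simp [a6, hx]⟩
  refine mkGeo (w := w) (w' := fun t => deriv (G f) (σ t) / 2) (y := fun t => s * G f (σ t))
    (y' := fun t => s * (deriv (G f) (σ t) * w t)) ht1 (fun t h => (hall t h).2.1)
    (fun t h => (hall t h).2.2.1) (fun t h => ?_) (fun t h => ?_) ?_ ?_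
    (fun t h => (hall t h).1) (fun t h => ?_) (fun t h => ?_) (fun t h => ?_)
  · exact ((hall t h).2.2.2.const_mul s).const_add x0
  · exact ((hd.hasDeriv (hall t h).1).comp_hasDerivWithinAt t (hall t h).2.1).const_mul s
  · exact hV'c.div_const 2
  · exact continuousOn_const.mul (hV'c.mul hwc)
  · have l1 : 0 ≤ x t := by
      rw [← a3]; exact hmono ⟨le_rfl, ht⟩ h h.1
    have l2 : x t ≤ L := by
      rw [← a6]; exact hmono h ⟨ht, le_rfl⟩ h.2
    rcases sq_eq_one_iff.mp hs with rfl | rfl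
    · exact hJ.out hx0 hx1 ⟨by linarith, by linarith⟩
    · exact hJ.out hx1 hx0 ⟨by linarith, by linarith⟩
  · have hp := hfpos _ (hall t h).1
    rw [G_deriv hd hf hfpos (hall t h).1, mul_pow, hs]
    unfold G
    field_simp
  · have hp := hfpos _ (hall t h).1
    rw [G_deriv hd hf hfpos (hall t h).1]
    unfold G
    field_simp

lemma vert {aE bE : EReal} {f : ℝ → ℝ} (hd : Dat (II aE bE) (G f)) {J : Set ℝ} {τ0 τ1 x0 : ℝ}
    (h0 : τ0 ∈ II aE bE) (h1 : τ1 ∈ II aE bE) (hx0 : x0 ∈ J) :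
    ∃ (σ x : ℝ → ℝ) (t1 : ℝ), 0 ≤ t1 ∧ IsGeodesicOn aE bE f J σ x 0 t1 ∧
      σ 0 = τ0 ∧ x 0 = x0 ∧ σ t1 = τ1 ∧ x t1 = x0 := by
  refine ⟨fun t => τ0 + t * (τ1 - τ0), fun _ => x0, 1, by norm_num, ?_, by simp, rfl, by simp, rfl⟩
  refine mkGeo (w := fun _ => τ1 - τ0) (w' := fun _ => 0) (y := fun _ => 0)
    (y' := fun _ => 0) one_pos (fun t h => ?_) (fun t h => hasDerivWithinAt_const _ _ _)
    (fun t h => hasDerivWithinAt_const _ _ _) (fun t h => hasDerivWithinAt_const _ _ _)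
    continuousOn_const continuousOn_const (fun t h => ?_) (fun t h => hx0) (by simp) (by simp)
  · simpa using (((hasDerivAt_id t).mul_const (τ1 - τ0)).const_add τ0).hasDerivWithinAt
  · have hc : Convex ℝ (II aE bE) := hd.ord.convex
    have := hc.add_smul_sub_mem h0 h1 h
    simpa using this

end GC

namespace GC

lemma connLe {aE bE : EReal} (hab : aE < bE) {f : ℝ → ℝ} (hd : Dat (II aE bE) (G f)) {J : Set ℝ}
    (hc : CondR aE bE f J) {L : ℝ} (hL : 0 < L)
    (hLd : (L : EReal) ≤ ((EMetric.diam J : ℝ≥0∞) : EReal)) {τ0 τ1 : ℝ}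
    (h0 : τ0 ∈ II aE bE) (h1 : τ1 ∈ II aE bE) (h01 : τ0 ≤ τ1) :
    ∃ v v', Flow (II aE bE) (G f) (τ0, v) (τ1, v') L := by
  obtain ⟨hm, hA, hB, hR⟩ := hc
  have h2 := mB_ex (aE := aE) hB
  have h3 := mA_ex (bE := bE) hA
  rcases h01.eq_or_lt with h | h
  · subst h
    have hμ : ∀ τ ∈ Icc τ0 τ0, G f τ0 ≤ G f τ := by
      intro τ hτ
      rw [Icc_self, mem_singleton_iff] at hτ
      rw [hτ]
    rcases lt_trichotomy (deriv (G f) τ0) 0 with hs | hs | hs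
    · exact half hab hd hm h2 h3 (hR τ0 h0).1 hLd h0 h0 le_rfl hμ (Or.inr ⟨rfl, hs⟩) hL
    · exact ⟨0, 0, Flow.const h0 hs (hd.pos τ0 h0) hL.le⟩
    · exact halfL hab hd hm h2 h3 (hR τ0 h0).2 hLd h0 h0 le_rfl hμ (Or.inr ⟨rfl, hs⟩) hL
  · have hI : Icc τ0 τ1 ⊆ II aE bE := hd.ord.out h0 h1
    obtain ⟨z, hz, hmin⟩ := exists_min hd h01 hI
    rcases hz.2.eq_or_lt with e | e
    · subst e
      exact half hab hd hm h2 h3 (hR τ0 h0).1 hLd h0 h1 h01 hmin (Or.inl h) hL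
    rcases hz.1.eq_or_lt with e' | e'
    · subst e'
      obtain ⟨v, v', hF⟩ := halfL hab hd hm h2 h3 (hR τ1 h1).2 hLd h1 h0 h01 hmin (Or.inl h) hL
      exact ⟨_, _, hF.rev⟩
    · have hloc : IsLocalMin (G f) z := by
        filter_upwards [Icc_mem_nhds e' e] with τ hτ using hmin τ hτ
      refine direct hd h hI hmin hL ?_
      rw [diverge hd h hI hz hloc.deriv_eq_zero le_rfl]
      exact ENNReal.ofReal_lt_top

end GC

/-- If Condition holds, the GRW spacetime `(a,b) × J` is
geodesically connected. -/
theorem geodesically_connected_of_CondR_implies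
    (aE bE : EReal) (hab : aE < bE) (f : ℝ → ℝ)
    (hf : ContDiffOn ℝ (⊤ : ℕ∞) f (II aE bE)) (hfpos : ∀ τ ∈ II aE bE, 0 < f τ)
    (J : Set ℝ) (hJ : ∃ c d : EReal, c < d ∧ J = {x : ℝ | c < (x : EReal) ∧ (x : EReal) < d})
    (hcond : CondR aE bE f J) :
    GeodConnected aE bE f J := by
  have hd := GC.mkDat hf hfpos
  have hO : OrdConnected J := by
    obtain ⟨c, d, -, rfl⟩ := hJ
    refine ⟨fun x hx y hy z hz => ⟨hx.1.trans_le ?_, lt_of_le_of_lt ?_ hy.2⟩⟩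
    · exact_mod_cast hz.1
    · exact_mod_cast hz.2
  intro τ0 x0 τ1 x1 h0 hx0 h1 hx1
  by_cases hx : x1 = x0
  · subst hx
    exact GC.vert hd h0 h1 hx0
  have hL : 0 < |x1 - x0| := abs_pos.mpr (sub_ne_zero.mpr hx)
  have hLd : ((|x1 - x0| : ℝ) : EReal) ≤ ((EMetric.diam J : ℝ≥0∞) : EReal) := by
    have h := EMetric.edist_le_diam_of_mem hx1 hx0
    rw [edist_dist, Real.dist_eq] at h
    have h' : ((ENNReal.ofReal |x1 - x0| : ℝ≥0∞) : EReal) ≤ ((EMetric.diam J : ℝ≥0∞) : EReal) :=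
      EReal.coe_ennreal_le_coe_ennreal_iff.mpr h
    rwa [EReal.coe_ennreal_ofReal, max_eq_left hL.le] at h'
  have hF : ∃ v v', GC.Flow (II aE bE) (G f) (τ0, v) (τ1, v') |x1 - x0| := by
    rcases le_total τ0 τ1 with h | h
    · exact GC.connLe hab hd hcond hL hLd h0 h1 h
    · obtain ⟨v, v', hF⟩ := GC.connLe hab hd hcond hL hLd h1 h0 h
      exact ⟨_, _, hF.rev⟩
  obtain ⟨v, v', hF⟩ := hF
  rcases le_total x0 x1 with h | h
  · refine GC.geo_of_flow hd hf hfpos hO hL (s := 1) (by norm_num) hx0 hx1 ?_ hF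
    rw [abs_of_nonneg (by linarith)]; ring
  · refine GC.geo_of_flow hd hf hfpos hO hL (s := -1) (by norm_num) hx0 hx1 ?_ hF
    rw [abs_of_nonpos (by linarith)]; ring
end
end

section
/- Let f : [τ0, τ1] → ℝ be a C² function with f > 0, and let a : [τ0, τ1] → ℝ be a C² solution of the Sturm equation a''(t) = (f''(t)/f(t))·a(t) with a(τ0) = 0 and a'(τ0) ≠ 0. Then a(t) ≠ 0 for every t ∈ (τ0, τ1]. (This is the Jacobi equation along a geodesic tangent to the base of a GRW spacetime with warping function f; the conclusion says such geodesics have no conjugate points.) -/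
open Set

/-- If `f : [τ0,τ1] → ℝ` is `C²` with `f > 0` and `a` is a `C²`
solution of the Sturm (Jacobi) equation `a'' = (f''/f)·a` with `a(τ0) = 0` and
`a'(τ0) ≠ 0`, then `a` does not vanish on `(τ0, τ1]`: geodesics tangent to the base of a
GRW spacetime have no conjugate points. -/
theorem sturm_no_conjugate_points
    (τ0 τ1 : ℝ) (h01 : τ0 < τ1) (f a : ℝ → ℝ)
    (hf : ContDiffOn ℝ 2 f (Icc τ0 τ1))
    (hfpos : ∀ t ∈ Icc τ0 τ1, 0 < f t)
    (ha : ContDiffOn ℝ 2 a (Icc τ0 τ1))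
    (heq : ∀ t ∈ Icc τ0 τ1,
      derivWithin (derivWithin a (Icc τ0 τ1)) (Icc τ0 τ1) t
        = (derivWithin (derivWithin f (Icc τ0 τ1)) (Icc τ0 τ1) t / f t) * a t)
    (h0 : a τ0 = 0) (h0' : derivWithin a (Icc τ0 τ1) τ0 ≠ 0) :
    ∀ t ∈ Ioc τ0 τ1, a t ≠ 0 := by
  set I := Icc τ0 τ1 with hI
  have hu : UniqueDiffOn ℝ I := uniqueDiffOn_Icc h01
  have key : ∀ g : ℝ → ℝ, ContDiffOn ℝ 2 g I → DifferentiableOn ℝ g I ∧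
      DifferentiableOn ℝ (derivWithin g I) I := fun g hg =>
    ⟨hg.differentiableOn (by norm_num),
      (hg.derivWithin hu (m := 1) (by norm_num)).differentiableOn (by norm_num)⟩
  obtain ⟨df, ddf⟩ := key f hf
  obtain ⟨da, dda⟩ := key a ha
  have hW : ∀ x ∈ I, HasDerivWithinAt
      (fun t => derivWithin a I t * f t - a t * derivWithin f I t) 0 I x := by
    intro x hx
    have h := ((dda x hx).hasDerivWithinAt.mul (df x hx).hasDerivWithinAt).sub
      ((da x hx).hasDerivWithinAt.mul (ddf x hx).hasDerivWithinAt)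
    refine h.congr_deriv ?_
    rw [heq x hx]
    have := (hfpos x hx).ne'
    field_simp
    ring
  have hconst := constant_of_derivWithin_zero (fun x hx => (hW x hx).differentiableWithinAt)
    (fun x hx => (hW x (Ico_subset_Icc_self hx)).derivWithin (hu x (Ico_subset_Icc_self hx)))
  have hτ : τ0 ∈ I := left_mem_Icc.2 h01.le
  intro t ht hat
  have hsub : Icc τ0 t ⊆ I := Icc_subset_Icc_right ht.2
  obtain ⟨c, hc, hc'⟩ := exists_hasDerivAt_eq_zero (f := fun x => a x / f x)
    (f' := fun x => (derivWithin a I x * f x - a x * derivWithin f I x) / f x ^ 2) ht.1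
    ((da.continuousOn.mono hsub).div (df.continuousOn.mono hsub)
      (fun x hx => (hfpos x (hsub hx)).ne')) (by simp [h0, hat]) (by
      intro x hx
      have hxI : x ∈ I := hsub (Ioo_subset_Icc_self hx)
      have hn : I ∈ nhds x := Icc_mem_nhds hx.1 (hx.2.trans_le ht.2)
      exact ((da x hxI).hasDerivWithinAt.hasDerivAt hn).div
        ((df x hxI).hasDerivWithinAt.hasDerivAt hn) (hfpos x hxI).ne')
  have hcI : c ∈ I := hsub (Ioo_subset_Icc_self hc)
  have h1 := hconst c hcI
  simp only [h0, zero_mul, sub_zero] at h1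
  simp only [h1] at hc'
  have h2 := (hfpos c hcI).ne'
  have h3 := (hfpos τ0 hτ).ne'
  exact div_ne_zero (mul_ne_zero h0' h3) (pow_ne_zero 2 h2) hc'
end

section
/- Let τ0 < τ1 < τ2 be real numbers, q : [τ0, τ2] → ℝ continuous, and λ, μ ∈ ℝ. Suppose a : [τ0, τ1] → ℝ is a C² solution of a'' − q·a + λ·a = 0 with a(τ0) = a(τ1) = 0 and a > 0 on (τ0, τ1), and b : [τ0, τ2] → ℝ is a C² solution of b'' − q·b + μ·b = 0 with b(τ0) = b(τ2) = 0 and b > 0 on (τ0, τ2). Then λ > μ. (Equivalently: the spectral flow τ ↦ λ_τ given by the first Dirichlet eigenvalue of −d²/dt² + q on [τ0, τ] is strictly decreasing in τ.) -/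
open Set

theorem aux_derivs (x y : ℝ) (hxy : x < y) (f : ℝ → ℝ) (hf : ContDiffOn ℝ 2 f (Icc x y)) :
    ContinuousOn (derivWithin f (Icc x y)) (Icc x y) ∧
    ∀ t ∈ Ioo x y, HasDerivAt f (derivWithin f (Icc x y) t) t ∧
      HasDerivAt (derivWithin f (Icc x y))
        (derivWithin (derivWithin f (Icc x y)) (Icc x y) t) t := by
  have hu := uniqueDiffOn_Icc hxy
  have h1 : ContDiffOn ℝ 1 (derivWithin f (Icc x y)) (Icc x y) :=
    hf.derivWithin hu (by norm_num)
  refine ⟨h1.continuousOn, fun t ht => ?_⟩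
  have hn : Icc x y ∈ nhds t := Icc_mem_nhds ht.1 ht.2
  have ht' : t ∈ Icc x y := Ioo_subset_Icc_self ht
  exact ⟨((hf.differentiableOn (by norm_num) t ht').hasDerivWithinAt).hasDerivAt hn,
    ((h1.differentiableOn (by norm_num) t ht').hasDerivWithinAt).hasDerivAt hn⟩

/-- Sturm comparison for the spectral flow: if `a` solves
`a'' − q·a + λ·a = 0` on `[τ0,τ1]` with Dirichlet conditions and `a > 0` inside, and `b`
solves `b'' − q·b + μ·b = 0` on the longer interval `[τ0,τ2]` with Dirichlet conditions
and `b > 0` inside, then `λ > μ`: the first Dirichlet eigenvalue of `−d²/dt² + q` is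
strictly decreasing in the interval. -/
theorem spectral_flow_strict_anti
    (τ0 τ1 τ2 : ℝ) (h01 : τ0 < τ1) (h12 : τ1 < τ2)
    (q : ℝ → ℝ) (hq : ContinuousOn q (Icc τ0 τ2)) (lam mu : ℝ)
    (a b : ℝ → ℝ)
    (ha : ContDiffOn ℝ 2 a (Icc τ0 τ1))
    (haeq : ∀ t ∈ Icc τ0 τ1,
      derivWithin (derivWithin a (Icc τ0 τ1)) (Icc τ0 τ1) t - q t * a t + lam * a t = 0)
    (ha0 : a τ0 = 0) (ha1 : a τ1 = 0) (hapos : ∀ t ∈ Ioo τ0 τ1, 0 < a t)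
    (hb : ContDiffOn ℝ 2 b (Icc τ0 τ2))
    (hbeq : ∀ t ∈ Icc τ0 τ2,
      derivWithin (derivWithin b (Icc τ0 τ2)) (Icc τ0 τ2) t - q t * b t + mu * b t = 0)
    (hb0 : b τ0 = 0) (hb2 : b τ2 = 0) (hbpos : ∀ t ∈ Ioo τ0 τ2, 0 < b t) :
    mu < lam := by
  by_contra hcon
  push Not at hcon
  obtain ⟨ca, da⟩ := aux_derivs τ0 τ1 h01 a ha
  obtain ⟨cb, db⟩ := aux_derivs τ0 τ2 (h01.trans h12) b hb
  set a' := derivWithin a (Icc τ0 τ1)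
  set b' := derivWithin b (Icc τ0 τ2)
  have hsub : Icc τ0 τ1 ⊆ Icc τ0 τ2 := Icc_subset_Icc_right h12.le
  have hW : MonotoneOn (fun t => a' t * b t - a t * b' t) (Icc τ0 τ1) := by
    apply monotoneOn_of_hasDerivWithinAt_nonneg (convex_Icc τ0 τ1)
      (f' := fun t => (mu - lam) * (a t * b t))
    · exact (ca.mul (hb.continuousOn.mono hsub)).sub (ha.continuousOn.mul (cb.mono hsub))
    · intro t ht
      rw [interior_Icc] at ht
      have ht2 : t ∈ Ioo τ0 τ2 := ⟨ht.1, ht.2.trans h12⟩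
      have h1 := da t ht
      have h2 := db t ht2
      have e1 := haeq t (Ioo_subset_Icc_self ht)
      have e2 := hbeq t (Ioo_subset_Icc_self ht2)
      have := (h1.2.mul h2.1).sub (h1.1.mul h2.2)
      refine (this.congr_deriv ?_).hasDerivWithinAt
      linear_combination b t * e1 - a t * e2
    · intro t ht
      rw [interior_Icc] at ht
      exact mul_nonneg (by linarith)
        (mul_pos (hapos t ht) (hbpos t ⟨ht.1, ht.2.trans h12⟩)).le
  have hmm : (τ0 + τ1) / 2 ∈ Ioo τ0 τ1 := ⟨by linarith, by linarith⟩
  set m := (τ0 + τ1) / 2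
  have hbp : ∀ t ∈ Icc m τ1, 0 < b t := fun t ht =>
    hbpos t ⟨hmm.1.trans_le ht.1, ht.2.trans_lt h12⟩
  have hms : Icc m τ1 ⊆ Icc τ0 τ1 := Icc_subset_Icc_left hmm.1.le
  have hR : MonotoneOn (fun t => a t / b t) (Icc m τ1) := by
    apply monotoneOn_of_hasDerivWithinAt_nonneg (convex_Icc m τ1)
      (f' := fun t => (a' t * b t - a t * b' t) / b t ^ 2)
    · exact (ha.continuousOn.mono hms).div (hb.continuousOn.mono (hms.trans hsub))
        (fun t ht => (hbp t ht).ne')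
    · intro t ht
      rw [interior_Icc] at ht
      have h1 := da t ⟨hmm.1.trans ht.1, ht.2⟩
      have h2 := db t ⟨hmm.1.trans ht.1, ht.2.trans h12⟩
      exact (h1.1.div h2.1 (hbp t (Ioo_subset_Icc_self ht)).ne').hasDerivWithinAt
    · intro t ht
      rw [interior_Icc] at ht
      have := hW (left_mem_Icc.2 h01.le) (hms (Ioo_subset_Icc_self ht)) (hmm.1.trans ht.1).le
      simp only [ha0, hb0, mul_zero, zero_mul, sub_zero] at this
      exact div_nonneg this (sq_nonneg _)
  have h := hR (left_mem_Icc.2 hmm.2.le) (right_mem_Icc.2 hmm.2.le) hmm.2.le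
  simp only [ha1, zero_div] at h
  exact absurd h (not_le.2 (div_pos (hapos m hmm) (hbp m (left_mem_Icc.2 hmm.2.le))))
end

section
/- Let γ : [0,1] → M, γ(t) = (τ(t), x(t)), be a geodesic of g^f with τ'(t) ≠ 0 for every t ∈ [0,1]. Then every Jacobi field along γ which vanishes at two distinct parameters t0 ≠ t1 in [0,1] vanishes identically; that is, no two points of γ are conjugate along γ. In particular, causal geodesics of M with nowhere-vanishing velocity are free of conjugate points. -/
open Set Filter MeasureTheory Topology
open scoped ENNReal NNReal

noncomputable section

open Set Filter MeasureTheory Topology GRW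
open scoped ENNReal

namespace GRW

/-- A Jacobi field `(u,v)` along a geodesic `(σ,x) : [0,1] → M` of `g^f`, i.e. a solution
of the linearized geodesic equations. -/
structure IsJacobiOn (f σ x u v : ℝ → ℝ) : Prop where
  smooth_u : ContDiffOn ℝ 2 u (Icc 0 1)
  smooth_v : ContDiffOn ℝ 2 v (Icc 0 1)
  eq_u : ∀ t ∈ Icc (0:ℝ) 1,
    derivWithin (derivWithin u (Icc 0 1)) (Icc 0 1) t
      = -(((deriv f (σ t)) ^ 2 + f (σ t) * deriv (deriv f) (σ t))
            * (derivWithin x (Icc 0 1) t) ^ 2 * u t)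
        - 2 * f (σ t) * deriv f (σ t) * derivWithin x (Icc 0 1) t
            * derivWithin v (Icc 0 1) t
  eq_v : ∀ t ∈ Icc (0:ℝ) 1,
    derivWithin (derivWithin v (Icc 0 1)) (Icc 0 1) t
      = -(2 * deriv (fun s => deriv f s / f s) (σ t) * derivWithin σ (Icc 0 1) t
            * derivWithin x (Icc 0 1) t * u t)
        - 2 * (deriv f (σ t) / f (σ t))
            * (derivWithin x (Icc 0 1) t * derivWithin u (Icc 0 1) t
                + derivWithin σ (Icc 0 1) t * derivWithin v (Icc 0 1) t)

end GRW

theorem jac_const {F : ℝ → ℝ} (h : ∀ t ∈ Icc (0:ℝ) 1, HasDerivWithinAt F 0 (Icc 0 1) t) :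
    ∀ t ∈ Icc (0:ℝ) 1, ∀ s ∈ Icc (0:ℝ) 1, F t = F s := by
  have key : ∀ t ∈ Icc (0:ℝ) 1, F t = F 0 := by
    apply constant_of_derivWithin_zero
    · exact fun t ht => (h t ht).differentiableWithinAt
    · intro t ht
      exact (h t (Ico_subset_Icc_self ht)).derivWithin
        (uniqueDiffOn_Icc one_pos t (Ico_subset_Icc_self ht))
  intro t ht s hs
  rw [key t ht, key s hs]

theorem jac_rolle {F F' : ℝ → ℝ} (h : ∀ t ∈ Icc (0:ℝ) 1, HasDerivWithinAt F (F' t) (Icc 0 1) t)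
    {t0 t1 : ℝ} (h0 : t0 ∈ Icc (0:ℝ) 1) (h1 : t1 ∈ Icc (0:ℝ) 1) (hne : t0 ≠ t1)
    (e0 : F t0 = 0) (e1 : F t1 = 0) : ∃ s ∈ Icc (0:ℝ) 1, F' s = 0 := by
  have key : ∀ a ∈ Icc (0:ℝ) 1, ∀ b ∈ Icc (0:ℝ) 1, a < b → F a = F b →
      ∃ s ∈ Icc (0:ℝ) 1, F' s = 0 := by
    intro a ha b hb hab e
    obtain ⟨s, hs, hs'⟩ := exists_hasDerivAt_eq_zero (f := F) (f' := F') hab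
      (fun t ht => ((h t ⟨ha.1.trans ht.1, ht.2.trans hb.2⟩).continuousWithinAt).mono
        (Icc_subset_Icc ha.1 hb.2)) e
      (fun t ht => (h t ⟨ha.1.trans ht.1.le, ht.2.le.trans hb.2⟩).hasDerivAt
        (Icc_mem_nhds (ha.1.trans_lt ht.1) (ht.2.trans_le hb.2)))
    exact ⟨s, ⟨ha.1.trans hs.1.le, hs.2.le.trans hb.2⟩, hs'⟩
  rcases lt_or_gt_of_ne hne with hlt | hlt
  · exact key _ h0 _ h1 hlt (e0.trans e1.symm)
  · exact key _ h1 _ h0 hlt (e1.trans e0.symm)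

theorem jac_core {F A B p q u v du dv : ℝ → ℝ}
    (hF0 : ∀ t ∈ Icc (0:ℝ) 1, F t ≠ 0) (hp0 : ∀ t ∈ Icc (0:ℝ) 1, p t ≠ 0)
    (hF : ∀ t ∈ Icc (0:ℝ) 1, HasDerivWithinAt F (A t * p t) (Icc 0 1) t)
    (hA : ∀ t ∈ Icc (0:ℝ) 1, HasDerivWithinAt A (B t * p t) (Icc 0 1) t)
    (hp : ∀ t ∈ Icc (0:ℝ) 1, HasDerivWithinAt p (-(F t * A t * q t ^ 2)) (Icc 0 1) t)
    (hq : ∀ t ∈ Icc (0:ℝ) 1, HasDerivWithinAt q (-(2 * (A t / F t) * p t * q t)) (Icc 0 1) t)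
    (hu : ∀ t ∈ Icc (0:ℝ) 1, HasDerivWithinAt u (du t) (Icc 0 1) t)
    (hv : ∀ t ∈ Icc (0:ℝ) 1, HasDerivWithinAt v (dv t) (Icc 0 1) t)
    (hdu : ∀ t ∈ Icc (0:ℝ) 1, HasDerivWithinAt du
      (-((A t ^ 2 + F t * B t) * q t ^ 2 * u t) - 2 * F t * A t * q t * dv t) (Icc 0 1) t)
    (hdv : ∀ t ∈ Icc (0:ℝ) 1, HasDerivWithinAt dv
      (-(2 * ((B t * F t - A t * A t) / F t ^ 2) * p t * q t * u t)
        - 2 * (A t / F t) * (q t * du t + p t * dv t)) (Icc 0 1) t)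
    {t0 t1 : ℝ} (h0 : t0 ∈ Icc (0:ℝ) 1) (h1 : t1 ∈ Icc (0:ℝ) 1) (hne : t0 ≠ t1)
    (u0 : u t0 = 0) (v0 : v t0 = 0) (u1 : u t1 = 0) (v1 : v t1 = 0) :
    ∀ t ∈ Icc (0:ℝ) 1, u t = 0 ∧ v t = 0 := by
  obtain ⟨c, hc⟩ : ∃ c, ∀ t ∈ Icc (0:ℝ) 1, F t ^ 2 * q t = c := by
    refine ⟨_, fun t ht => jac_const (F := fun t => F t ^ 2 * q t) ?_ t ht t0 h0⟩
    intro t ht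
    have := hF0 t ht
    refine HasDerivWithinAt.congr_deriv ((((hF t ht).pow 2).mul (hq t ht))) ?_
    simp
    field_simp
    ring
  obtain ⟨D, hD⟩ : ∃ D, ∀ t ∈ Icc (0:ℝ) 1, -p t ^ 2 + F t ^ 2 * q t ^ 2 = D := by
    refine ⟨_, fun t ht => jac_const (F := fun t => -p t ^ 2 + F t ^ 2 * q t ^ 2) ?_ t ht t0 h0⟩
    intro t ht
    have := hF0 t ht
    refine HasDerivWithinAt.congr_deriv (((hp t ht).pow 2).neg.add (((hF t ht).pow 2).mul ((hq t ht).pow 2))) ?_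
    simp
    field_simp
    ring
  obtain ⟨E, hE⟩ : ∃ E, ∀ t ∈ Icc (0:ℝ) 1, 2 * (F t * A t * u t * q t) + F t ^ 2 * dv t = E := by
    refine ⟨_, fun t ht => jac_const
      (F := fun t => 2 * (F t * A t * u t * q t) + F t ^ 2 * dv t) ?_ t ht t0 h0⟩
    intro t ht
    have := hF0 t ht
    refine HasDerivWithinAt.congr_deriv ((((((hF t ht).mul (hA t ht)).mul (hu t ht)).mul (hq t ht)).const_mul 2).add
      (((hF t ht).pow 2).mul (hdv t ht))) ?_
    simp
    field_simp
    ring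
  obtain ⟨K, hK⟩ : ∃ K, ∀ t ∈ Icc (0:ℝ) 1,
      -(p t * du t) + F t * A t * u t * q t ^ 2 + F t ^ 2 * q t * dv t = K := by
    refine ⟨_, fun t ht => jac_const
      (F := fun t => -(p t * du t) + F t * A t * u t * q t ^ 2 + F t ^ 2 * q t * dv t) ?_ t ht t0 h0⟩
    intro t ht
    have := hF0 t ht
    refine HasDerivWithinAt.congr_deriv ((((hp t ht).mul (hdu t ht)).neg.add
      ((((hF t ht).mul (hA t ht)).mul (hu t ht)).mul ((hq t ht).pow 2))).add
      ((((hF t ht).pow 2).mul (hq t ht)).mul (hdv t ht))) ?_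
    simp
    field_simp
    ring
  have hy : ∀ t ∈ Icc (0:ℝ) 1, HasDerivWithinAt (fun t => u t / p t)
      ((q t * E - K) / p t ^ 2) (Icc 0 1) t := by
    intro t ht
    refine HasDerivWithinAt.congr_deriv ((hu t ht).div (hp t ht) (hp0 t ht)) ?_
    rw [← hE t ht, ← hK t ht]
    ring
  have hw : ∀ t ∈ Icc (0:ℝ) 1, HasDerivWithinAt (fun t => v t - q t * (u t / p t))
      ((c * K - D * E) / (F t ^ 2 * p t ^ 2)) (Icc 0 1) t := by
    intro t ht
    have := hF0 t ht
    have := hp0 t ht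
    refine HasDerivWithinAt.congr_deriv ((hv t ht).sub ((hq t ht).mul (hy t ht))) ?_
    have e : dv t = (E - 2 * (F t * A t * u t * q t)) / F t ^ 2 := by
      rw [← hE t ht]; field_simp; ring
    rw [e, ← hc t ht, ← hD t ht]
    field_simp
    ring
  obtain ⟨s, hs, hs'⟩ := jac_rolle hw h0 h1 hne (by simp [u0, v0]) (by simp [u1, v1])
  obtain ⟨r, hr, hr'⟩ := jac_rolle hy h0 h1 hne (by simp [u0]) (by simp [u1])
  have k1 : c * K - D * E = 0 := by
    have := hF0 s hs
    have := hp0 s hs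
    rcases div_eq_zero_iff.1 hs' with h | h
    · exact h
    · exact absurd h (by positivity)
  have k2 : q r * E - K = 0 := by
    have := hp0 r hr
    rcases div_eq_zero_iff.1 hr' with h | h
    · exact h
    · exact absurd h (by positivity)
  have hE0 : E = 0 := by
    have e : p r ^ 2 * E = 0 := by
      have a := hc r hr
      have b := hD r hr
      linear_combination (-E) * b + q r * E * a + k1 + c * k2
    rcases mul_eq_zero.1 e with h | h
    · exact absurd h (pow_ne_zero 2 (hp0 r hr))
    · exact h
  have hK0 : K = 0 := by rw [hE0] at k2; linarith
  intro t ht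
  have a := jac_const (fun t ht => by simpa [hE0, hK0] using hy t ht) t ht t0 h0
  have b := jac_const (fun t ht => by simpa [hE0, hK0] using hw t ht) t ht t0 h0
  simp only [u0, v0, zero_div, mul_zero, sub_zero] at a b
  rw [a] at b
  refine ⟨?_, by linarith⟩
  rcases div_eq_zero_iff.1 a with h | h
  · exact h
  · exact absurd h (hp0 t ht)

theorem II_open (aE bE : EReal) : IsOpen (II aE bE) :=
  (isOpen_Ioo (a := aE) (b := bE)).preimage continuous_coe_real_ereal

theorem hd_one {g : ℝ → ℝ} (h : ContDiffOn ℝ 2 g (Icc 0 1)) :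
    ∀ t ∈ Icc (0:ℝ) 1, HasDerivWithinAt g (derivWithin g (Icc 0 1) t) (Icc 0 1) t :=
  fun t ht => (h.differentiableOn (by norm_num) t ht).hasDerivWithinAt

theorem hd_two {g : ℝ → ℝ} (h : ContDiffOn ℝ 2 g (Icc 0 1)) :
    ∀ t ∈ Icc (0:ℝ) 1, HasDerivWithinAt (derivWithin g (Icc 0 1))
      (derivWithin (derivWithin g (Icc 0 1)) (Icc 0 1) t) (Icc 0 1) t :=
  fun t ht => ((h.derivWithin (m := 1) (uniqueDiffOn_Icc one_pos) (by norm_num)).differentiableOn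
    (by norm_num) t ht).hasDerivWithinAt

/-- Along a geodesic `γ = (σ,x) : [0,1] → M` of `g^f` whose `τ`
component has nowhere-vanishing derivative, every Jacobi field vanishing at two distinct
parameters vanishes identically; hence no two points of `γ` are conjugate along `γ`. In
particular causal geodesics with nowhere-vanishing velocity are free of conjugate
points. -/
theorem no_conjugate_points_of_tau_deriv_ne_zero
    (aE bE : EReal) (hab : aE < bE) (f : ℝ → ℝ)
    (hf : ContDiffOn ℝ (⊤ : ℕ∞) f (II aE bE)) (hfpos : ∀ τ ∈ II aE bE, 0 < f τ)
    (J : Set ℝ) (hJ : ∃ c d : EReal, c < d ∧ J = {x : ℝ | c < (x : EReal) ∧ (x : EReal) < d})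
    (σ x : ℝ → ℝ) (hgeo : IsGeodesicOn aE bE f J σ x 0 1)
    (hτ' : ∀ t ∈ Icc (0:ℝ) 1, derivWithin σ (Icc 0 1) t ≠ 0) :
    ∀ u v : ℝ → ℝ, IsJacobiOn f σ x u v →
      ∀ t0 ∈ Icc (0:ℝ) 1, ∀ t1 ∈ Icc (0:ℝ) 1, t0 ≠ t1 →
        u t0 = 0 → v t0 = 0 → u t1 = 0 → v t1 = 0 →
        ∀ t ∈ Icc (0:ℝ) 1, u t = 0 ∧ v t = 0 := by
  intro u v hJac t0 h0 t1 h1 hne u0 v0 u1 v1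
  have hop := II_open aE bE
  have hf2 : ContDiffOn ℝ 2 f (II aE bE) := contDiffOn_infty.1 hf 2
  have hf1 : ContDiffOn ℝ 1 (deriv f) (II aE bE) :=
    hf2.deriv_of_isOpen hop (by norm_num)
  have d1 : ∀ s ∈ II aE bE, HasDerivAt f (deriv f s) s := fun s hs =>
    ((hf2.differentiableOn (by norm_num) s hs).differentiableAt (hop.mem_nhds hs)).hasDerivAt
  have d2 : ∀ s ∈ II aE bE, HasDerivAt (deriv f) (deriv (deriv f) s) s := fun s hs =>
    ((hf1.differentiableOn (by norm_num) s hs).differentiableAt (hop.mem_nhds hs)).hasDerivAt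
  have hm := hgeo.mem_base
  refine jac_core (F := fun t => f (σ t)) (A := fun t => deriv f (σ t))
    (B := fun t => deriv (deriv f) (σ t)) (p := derivWithin σ (Icc 0 1))
    (q := derivWithin x (Icc 0 1)) (du := derivWithin u (Icc 0 1)) (dv := derivWithin v (Icc 0 1))
    (fun t ht => (hfpos _ (hm t ht)).ne') hτ' ?_ ?_ ?_ ?_
    (hd_one hJac.smooth_u) (hd_one hJac.smooth_v) ?_ ?_ h0 h1 hne u0 v0 u1 v1
  · exact fun t ht => (d1 _ (hm t ht)).comp_hasDerivWithinAt t (hd_one hgeo.smooth_base t ht)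
  · exact fun t ht => (d2 _ (hm t ht)).comp_hasDerivWithinAt t (hd_one hgeo.smooth_base t ht)
  · intro t ht
    have := hd_two hgeo.smooth_base t ht
    rwa [hgeo.eq_base t ht] at this
  · intro t ht
    have := hd_two hgeo.smooth_fiber t ht
    rwa [hgeo.eq_fiber t ht] at this
  · intro t ht
    have := hd_two hJac.smooth_u t ht
    rwa [hJac.eq_u t ht] at this
  · intro t ht
    have := hd_two hJac.smooth_v t ht
    have e : deriv (fun s => deriv f s / f s) (σ t) = _ :=
      ((d2 _ (hm t ht)).div (d1 _ (hm t ht)) (hfpos _ (hm t ht)).ne').deriv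
    rwa [hJac.eq_v t ht, e] at this
end
end
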